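/- arXiv:2503.19489 — 4 statements merged into one kernel-verified Lean document; each statement's English description precedes it below -/
import Mathlib

section
/- Let G be a θ_{2,2,3}-free graph with m edges and no isolated vertices, where m ≥ 57. Then λ(G) = (1 + √(4m − 3))/2 if and only if G is isomorphic to K₂ ∨ ((m−1)/2)K₁, the join of an edge with (m−1)/2 isolated vertices (in particular m is odd). -/
open SimpleGraph

/-- `F` is contained in `G` as a (not necessarily induced) subgraph. -/
def Contains {α β : Type*} (F : SimpleGraph α) (G : SimpleGraph β) : Prop :=
  ∃ f : α ↪ β, ∀ ⦃a b⦄, F.Adj a b → G.Adj (f a) (f b)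

/-- The theta graph θ_{2,2,3}: vertices 0 = a, 1 = b, 2 = c₁, 3 = c₂, 4 = d₁, 5 = d₂,
with edges ac₁, c₁b, ac₂, c₂b, ad₁, d₁d₂, d₂b. -/
def theta223 : SimpleGraph (Fin 6) :=
  SimpleGraph.fromRel (fun x y =>
    (x = 0 ∧ y = 2) ∨ (x = 2 ∧ y = 1) ∨ (x = 0 ∧ y = 3) ∨ (x = 3 ∧ y = 1) ∨
    (x = 0 ∧ y = 4) ∨ (x = 4 ∧ y = 5) ∨ (x = 5 ∧ y = 1))

open Classical in
/-- The real adjacency matrix of a simple graph. -/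
noncomputable def adjMat {V : Type*} (G : SimpleGraph V) : Matrix V V ℝ :=
  Matrix.of fun a b => if G.Adj a b then 1 else 0

/-- `lam` is the largest eigenvalue (spectral radius) of the adjacency matrix of `G`. -/
def IsSpectralRadius {V : Type*} [Fintype V] (G : SimpleGraph V) (lam : ℝ) : Prop :=
  (∃ v : V → ℝ, v ≠ 0 ∧ (adjMat G).mulVec v = lam • v) ∧
  ∀ (μ : ℝ) (v : V → ℝ), v ≠ 0 → (adjMat G).mulVec v = μ • v → μ ≤ lam

/-- The join K₂ ∨ kK₁ : two adjacent dominating vertices joined to k pairwise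
nonadjacent vertices. -/
def K2JoinEmpty (k : ℕ) : SimpleGraph (Fin 2 ⊕ Fin k) :=
  SimpleGraph.fromRel (fun x _ => x.isLeft)

/-- The star K_{1,r} with center 0 and r leaves. -/
def starGraph (r : ℕ) : SimpleGraph (Fin (r + 1)) :=
  SimpleGraph.fromRel (fun x _ => x = 0)

/-- The double star S_{1,2}: central edge 01, leaf 2 adjacent to 0, leaves 3, 4 adjacent to 1. -/
def doubleStarS12 : SimpleGraph (Fin 5) :=
  SimpleGraph.fromRel (fun x y =>
    (x = 0 ∧ y = 1) ∨ (x = 0 ∧ y = 2) ∨ (x = 1 ∧ y = 3) ∨ (x = 1 ∧ y = 4))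

/-- K_{1,3}+e: the star with center 0 and leaves 1, 2, 3, plus the edge 12. -/
def K13e : SimpleGraph (Fin 4) :=
  SimpleGraph.fromRel (fun x y => x = 0 ∨ (x = 1 ∧ y = 2))

/-- K₄ − e: the complete graph on four vertices minus the edge 23. -/
def K4e : SimpleGraph (Fin 4) :=
  SimpleGraph.fromRel (fun x y => ¬(x = 2 ∧ y = 3) ∧ ¬(x = 3 ∧ y = 2))


open Finset in
/-- Perron-type lemma: the largest eigenvalue has a nonnegative eigenvector. -/
lemma exists_nonneg_eigvec {V : Type*} [Fintype V] (G : SimpleGraph V) (lam : ℝ)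
    (hlam : IsSpectralRadius G lam) :
    ∃ y : V → ℝ, y ≠ 0 ∧ (∀ v, 0 ≤ y v) ∧ (adjMat G).mulVec y = lam • y := by
  classical
  obtain ⟨⟨v, hv0, hv⟩, hmax⟩ := hlam
  have hA : (adjMat G).IsHermitian := by
    ext i j
    simp [adjMat, G.adj_comm]
  have hB : (lam • (1 : Matrix V V ℝ) - adjMat G).IsHermitian := by
    refine Matrix.IsHermitian.sub ?_ hA
    ext i j
    simp [Matrix.one_apply, eq_comm]
  have hP : (lam • (1 : Matrix V V ℝ) - adjMat G).PosSemidef := by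
    rw [hB.posSemidef_iff_eigenvalues_nonneg]
    intro i
    have h1 := hB.mulVec_eigenvectorBasis i
    have h2 : (⇑(hB.eigenvectorBasis i) : V → ℝ) ≠ 0 := by
      intro h
      have := hB.eigenvectorBasis.toBasis.ne_zero i
      apply this
      ext j
      simpa using congrFun h j
    have h3 := hmax (lam - hB.eigenvalues i) _ h2 (by
      rw [Matrix.sub_mulVec, Matrix.smul_mulVec, Matrix.one_mulVec] at h1
      rw [sub_smul, ← h1]
      abel)
    simp only [Pi.zero_apply]
    linarith
  refine ⟨fun i => |v i|, ?_, fun i => abs_nonneg _, ?_⟩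
  · intro h
    apply hv0
    ext i
    simpa using congrFun h i
  · set y : V → ℝ := fun i => |v i| with hy
    have key : (star y) ⬝ᵥ ((lam • (1 : Matrix V V ℝ) - adjMat G).mulVec y) = 0 := by
      apply le_antisymm
      · have e1 : v ⬝ᵥ ((adjMat G).mulVec v) = lam * (v ⬝ᵥ v) := by
          rw [hv, dotProduct_smul, smul_eq_mul]
        have e2 : y ⬝ᵥ y = v ⬝ᵥ v := by
          simp [dotProduct, hy]
        have e3 : v ⬝ᵥ ((adjMat G).mulVec v) ≤ y ⬝ᵥ ((adjMat G).mulVec y) := by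
          simp only [dotProduct, Matrix.mulVec, Finset.mul_sum]
          refine Finset.sum_le_sum fun i _ => Finset.sum_le_sum fun j _ => ?_
          simp only [adjMat, Matrix.of_apply, hy]
          split_ifs
          · rw [one_mul, one_mul, ← abs_mul]; exact le_abs_self _
          · simp
        have e4 : (star y) ⬝ᵥ ((lam • (1 : Matrix V V ℝ) - adjMat G).mulVec y)
            = lam * (y ⬝ᵥ y) - y ⬝ᵥ ((adjMat G).mulVec y) := by
          rw [Matrix.sub_mulVec, Matrix.smul_mulVec, Matrix.one_mulVec, dotProduct_sub,
            dotProduct_smul, smul_eq_mul]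
          simp
        rw [e4, e2]
        linarith
      · exact hP.dotProduct_mulVec_nonneg y
    have h5 := (hP.dotProduct_mulVec_zero_iff y).1 key
    rw [Matrix.sub_mulVec, Matrix.smul_mulVec, Matrix.one_mulVec, sub_eq_zero] at h5
    exact h5.symm

/-- The theta-free condition, unpacked. -/
lemma theta_unpack {V : Type*} (G : SimpleGraph V) (hfree : ¬ Contains theta223 G)
    (a b c₁ c₂ d₁ d₂ : V) (h1 : G.Adj a c₁) (h2 : G.Adj c₁ b) (h3 : G.Adj a c₂)
    (h4 : G.Adj c₂ b) (h5 : G.Adj a d₁) (h6 : G.Adj d₁ d₂) (h7 : G.Adj d₂ b)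
    (hab : a ≠ b) (hc : c₁ ≠ c₂) (h8 : c₁ ≠ d₁) (h9 : c₁ ≠ d₂) (h10 : c₂ ≠ d₁) (h11 : c₂ ≠ d₂)
    (h12 : a ≠ d₂) (h13 : b ≠ d₁) : False := by
  apply hfree
  have n1 := h1.ne
  have n2 := h2.ne
  have n3 := h3.ne
  have n4 := h4.ne
  have n5 := h5.ne
  have n6 := h6.ne
  have n7 := h7.ne
  have hinj : Function.Injective ![a, b, c₁, c₂, d₁, d₂] := by
    intro i j hij
    fin_cases i <;> fin_cases j <;> first
      | rfl
      | exact (hab hij).elim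
      | exact (hab hij.symm).elim
      | exact (hc hij).elim
      | exact (hc hij.symm).elim
      | exact (h8 hij).elim
      | exact (h8 hij.symm).elim
      | exact (h9 hij).elim
      | exact (h9 hij.symm).elim
      | exact (h10 hij).elim
      | exact (h10 hij.symm).elim
      | exact (h11 hij).elim
      | exact (h11 hij.symm).elim
      | exact (h12 hij).elim
      | exact (h12 hij.symm).elim
      | exact (h13 hij).elim
      | exact (h13 hij.symm).elim
      | exact (n1 hij).elim
      | exact (n1 hij.symm).elim
      | exact (n2 hij).elim
      | exact (n2 hij.symm).elim
      | exact (n3 hij).elim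
      | exact (n3 hij.symm).elim
      | exact (n4 hij).elim
      | exact (n4 hij.symm).elim
      | exact (n5 hij).elim
      | exact (n5 hij.symm).elim
      | exact (n6 hij).elim
      | exact (n6 hij.symm).elim
      | exact (n7 hij).elim
      | exact (n7 hij.symm).elim
  refine ⟨⟨![a, b, c₁, c₂, d₁, d₂], hinj⟩, ?_⟩
  · intro i j hij
    change G.Adj (![a, b, c₁, c₂, d₁, d₂] i) (![a, b, c₁, c₂, d₁, d₂] j)
    simp only [theta223, SimpleGraph.fromRel_adj] at hij
    obtain ⟨-, hij⟩ := hij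
    rcases hij with hij | hij <;>
    rcases hij with ⟨rfl, rfl⟩ | ⟨rfl, rfl⟩ | ⟨rfl, rfl⟩ | ⟨rfl, rfl⟩ | ⟨rfl, rfl⟩ | ⟨rfl, rfl⟩ |
      ⟨rfl, rfl⟩ <;> simp [h1, h2, h3, h4, h5, h6, h7, h1.symm, h2.symm, h3.symm, h4.symm, h5.symm,
        h6.symm, h7.symm]

/-- Recognising `K₂ ∨ kK₁`. -/
lemma iso_of_struct {V : Type*} [Fintype V] (G : SimpleGraph V) (u c : V) (huc : u ≠ c)
    (hu : ∀ v, v ≠ u → G.Adj u v) (hc : ∀ v, v ≠ c → G.Adj c v)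
    (hl : ∀ v w, v ≠ u → v ≠ c → w ≠ u → w ≠ c → ¬ G.Adj v w) (k : ℕ)
    (hk : Fintype.card V = k + 2) : Nonempty (G ≃g K2JoinEmpty k) := by
  classical
  have hcard : Fintype.card {v : V // v ≠ u ∧ v ≠ c} = k := by
    rw [Fintype.card_subtype]
    have : (Finset.univ.filter fun v : V => v ≠ u ∧ v ≠ c) = (Finset.univ.erase u).erase c := by
      ext v; simp [and_comm]
    rw [this, Finset.card_erase_of_mem (by simp [huc.symm]), Finset.card_erase_of_mem (by simp),
      Finset.card_univ, hk]
    rfl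
  let e := (Fintype.equivFinOfCardEq hcard).symm
  let f : Fin 2 ⊕ Fin k → V := Sum.elim ![u, c] (fun i => (e i).1)
  have hf : Function.Bijective f := by
    constructor
    · rintro (i | i) (j | j) hij
      · fin_cases i <;> fin_cases j <;> simp_all [f]
      · have := (e j).2
        fin_cases i <;> simp_all [f]
      · have := (e i).2
        fin_cases j <;> simp_all [f]
      · simp only [f, Sum.elim_inr] at hij
        rw [e.injective (Subtype.ext hij)]
    · intro v
      by_cases h1 : v = u
      · exact ⟨Sum.inl 0, by simp [f, h1]⟩
      by_cases h2 : v = c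
      · exact ⟨Sum.inl 1, by simp [f, h2]⟩
      · exact ⟨Sum.inr (e.symm ⟨v, h1, h2⟩), by simp [f]⟩
  refine ⟨(RelIso.symm ⟨Equiv.ofBijective f hf, ?_⟩ : G ≃g K2JoinEmpty k)⟩
  intro a b
  simp only [Equiv.ofBijective_apply, K2JoinEmpty, SimpleGraph.fromRel_adj]
  have hne : f a ≠ f b ↔ a ≠ b := hf.1.ne_iff
  rcases a with i | i
  · have : G.Adj (f (Sum.inl i)) (f b) ↔ f (Sum.inl i) ≠ f b := by
      refine ⟨fun h => h.ne, fun h => ?_⟩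
      fin_cases i
      · exact hu _ h.symm
      · exact hc _ h.symm
    rw [this, hne]; simp
  · rcases b with j | j
    · have : G.Adj (f (Sum.inr i)) (f (Sum.inl j)) ↔ f (Sum.inr i) ≠ f (Sum.inl j) := by
        refine ⟨fun h => h.ne, fun h => ?_⟩
        fin_cases j
        · exact (hu _ h).symm
        · exact (hc _ h).symm
      rw [this, hne]; simp
    · have := hl (e i).1 (e j).1 (e i).2.1 (e i).2.2 (e j).2.1 (e j).2.2
      simp [f, this]

/-- The easy direction. -/
lemma easy_dir {V : Type*} [Fintype V] (G : SimpleGraph V) (k : ℕ)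
    (lam : ℝ) (hlam : IsSpectralRadius G lam) (e : G ≃g K2JoinEmpty k) (mu : ℝ) (hmu : 0 < mu)
    (hmu2 : mu ^ 2 - mu = 2 * k) : lam = mu := by
  classical
  obtain ⟨⟨v, hv0, hv⟩, hmax⟩ := hlam
  let g : Fin 2 ⊕ Fin k → ℝ := Sum.elim (fun _ => mu) (fun _ => 2)
  let z : V → ℝ := fun v => g (e v)
  have gpos : ∀ i, 0 < g i := by rintro (i | i) <;> simp [g, hmu]
  have zpos : ∀ i, 0 < z i := fun i => gpos _
  have hz : (adjMat G).mulVec z = mu • z := by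
    ext a
    have h1 : (adjMat G).mulVec z a
        = ∑ b : Fin 2 ⊕ Fin k, (if (K2JoinEmpty k).Adj (e a) b then (1 : ℝ) else 0) * g b := by
      rw [← e.toEquiv.sum_comp]
      simp only [Matrix.mulVec, dotProduct, adjMat, Matrix.of_apply, z]
      refine Finset.sum_congr rfl fun b _ => ?_
      congr 1
      have : (K2JoinEmpty k).Adj (e a) (e b) ↔ G.Adj a b := e.map_rel_iff
      by_cases h : G.Adj a b
      · have h' := this.2 h
        simp [h, h']
      · have h' : ¬ (K2JoinEmpty k).Adj (e a) (e b) := fun q => h (this.1 q)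
        simp [h, h']
    rw [h1]
    simp only [Pi.smul_apply, z, smul_eq_mul]
    generalize e a = i
    rw [Fintype.sum_sum_type]
    rcases i with i | i
    · fin_cases i <;> simp [K2JoinEmpty, g, Fin.sum_univ_two] <;> nlinarith
    · simp [K2JoinEmpty, g, Fin.sum_univ_two]; ring
  have hsup : mu ≤ lam := by
    refine hmax mu z ?_ hz
    intro h
    obtain ⟨i, hi⟩ := Function.ne_iff.1 hv0
    have := zpos i
    rw [h] at this
    simp at this
  refine le_antisymm ?_ hsup
  have hpt : ∀ i, lam * |v i| ≤ ∑ j, (adjMat G) i j * |v j| := by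
    intro i
    have h1 := congrFun hv i
    simp only [Matrix.mulVec, dotProduct, Pi.smul_apply, smul_eq_mul] at h1
    calc lam * |v i| = |lam * v i| := by rw [abs_mul, abs_of_nonneg (by linarith : 0 ≤ lam)]
      _ = |∑ j, (adjMat G) i j * v j| := by rw [h1]
      _ ≤ ∑ j, |(adjMat G) i j * v j| := Finset.abs_sum_le_sum_abs _ _
      _ = _ := by
        refine Finset.sum_congr rfl fun j _ => ?_
        rw [abs_mul, abs_of_nonneg]
        simp only [adjMat, Matrix.of_apply]; split_ifs <;> norm_num
  have hsym : ∀ i j, adjMat G i j = adjMat G j i := by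
    intro i j; simp [adjMat, G.adj_comm]
  have h2 : lam * ∑ i, z i * |v i| ≤ mu * ∑ i, z i * |v i| := by
    calc lam * ∑ i, z i * |v i| = ∑ i, z i * (lam * |v i|) := by
          rw [Finset.mul_sum]; exact Finset.sum_congr rfl fun i _ => by ring
      _ ≤ ∑ i, z i * ∑ j, (adjMat G) i j * |v j| :=
          Finset.sum_le_sum fun i _ => mul_le_mul_of_nonneg_left (hpt i) (zpos i).le
      _ = ∑ j, (∑ i, (adjMat G) j i * z i) * |v j| := by
          simp only [Finset.mul_sum, Finset.sum_mul]
          rw [Finset.sum_comm]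
          refine Finset.sum_congr rfl fun j _ => Finset.sum_congr rfl fun i _ => ?_
          rw [hsym i j]; ring
      _ = ∑ j, (mu * z j) * |v j| := by
          refine Finset.sum_congr rfl fun j _ => ?_
          have := congrFun hz j
          simp only [Matrix.mulVec, dotProduct, Pi.smul_apply, smul_eq_mul] at this
          rw [this]
      _ = _ := by
          rw [Finset.mul_sum]; exact Finset.sum_congr rfl fun i _ => by ring
  have hpos : 0 < ∑ i, z i * |v i| := by
    obtain ⟨i, hi⟩ := Function.ne_iff.1 hv0
    refine Finset.sum_pos' (fun i _ => mul_nonneg (zpos i).le (abs_nonneg _)) ⟨i, by simp, ?_⟩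
    exact mul_pos (zpos i) (abs_pos.2 hi)
  exact le_of_mul_le_mul_right h2 hpos

open Finset in
/-- The main combinatorial/spectral argument. -/
lemma hard_core {V : Type*} [Fintype V] (G : SimpleGraph V)
    (hfree : ¬ Contains theta223 G) (hiso : ∀ v : V, ∃ w, G.Adj v w)
    (A : V → V → ℝ) (hA1 : ∀ a b, G.Adj a b → A a b = 1) (hA0 : ∀ a b, ¬ G.Adj a b → A a b = 0)
    (m lam : ℝ) (h2m : ∑ a, ∑ b, A a b = 2 * m) (hlm : lam ^ 2 - lam = m - 1) (hl8 : 8 ≤ lam)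
    (x : V → ℝ) (hx0 : ∀ v, 0 ≤ x v) (hx1 : ∀ v, x v ≤ 1)
    (hx : ∀ v, lam * x v = ∑ w, A v w * x w) (u : V) (hu : x u = 1) :
    ∃ c, u ≠ c ∧ (∀ v, v ≠ u → G.Adj u v) ∧ (∀ v, v ≠ c → G.Adj c v) ∧
      (∀ v w, v ≠ u → v ≠ c → w ≠ u → w ≠ c → ¬ G.Adj v w) ∧
      m = 2 * ((Fintype.card V : ℝ) - 2) + 1 := by
  classical
  have hAs : ∀ a b, A a b = A b a := by
    intro a b
    by_cases h : G.Adj a b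
    · rw [hA1 _ _ h, hA1 _ _ h.symm]
    · rw [hA0 _ _ h, hA0 _ _ (fun q => h q.symm)]
  have hAn : ∀ a b, 0 ≤ A a b := by
    intro a b
    by_cases h : G.Adj a b
    · rw [hA1 _ _ h]; norm_num
    · rw [hA0 _ _ h]
  obtain ⟨N, hN⟩ : ∃ N : Finset V, ∀ v, v ∈ N ↔ G.Adj u v :=
    ⟨univ.filter (G.Adj u), by simp⟩
  obtain ⟨W, hW⟩ : ∃ W : Finset V, ∀ v, v ∈ W ↔ v ≠ u ∧ ¬ G.Adj u v :=
    ⟨univ.filter (fun v => v ≠ u ∧ ¬ G.Adj u v), by simp⟩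
  have hsplit : ∀ F : V → ℝ, ∑ v, F v = F u + ∑ v ∈ N, F v + ∑ v ∈ W, F v := by
    intro F
    have e1 : (univ : Finset V) = insert u (N ∪ W) := by
      ext v
      simp only [mem_univ, mem_insert, mem_union, hN, hW, true_iff]
      tauto
    rw [e1, sum_insert, sum_union]
    · ring
    · rw [Finset.disjoint_left]
      intro v h1 h2
      exact ((hW v).1 h2).2 ((hN v).1 h1)
    · simp [hN, hW]
  have huN : ∀ v ∈ N, A v u = 1 := fun v hv => hA1 _ _ ((hN v).1 hv).symm
  have huW : ∀ v ∈ W, A v u = 0 := fun v hv => hA0 _ _ (fun q => ((hW v).1 hv).2 q.symm)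
  have huu : A u u = 0 := hA0 _ _ (G.loopless.irrefl u)
  obtain ⟨k, hk⟩ : ∃ k : V → ℕ, ∀ v, k v = (N.filter (G.Adj v)).card := ⟨_, fun _ => rfl⟩
  have hkA : ∀ v, ∑ w ∈ N, A v w = k v := by
    intro v
    rw [hk, card_filter, Nat.cast_sum]
    refine sum_congr rfl fun w _ => ?_
    by_cases h : G.Adj v w
    · simp [h, hA1 _ _ h]
    · simp [h, hA0 _ _ h]
  obtain ⟨dW, hdW⟩ : ∃ d : V → ℝ, ∀ v, d v = ∑ w ∈ W, A v w := ⟨_, fun _ => rfl⟩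
  have hdW0 : ∀ v, 0 ≤ dW v := fun v => by rw [hdW]; exact sum_nonneg fun w _ => hAn _ _
  -- local upper bounds
  have hSN : ∀ v, ∑ w ∈ N, A v w * x w ≤ k v := by
    intro v
    rw [← hkA]
    exact sum_le_sum fun w _ => mul_le_of_le_one_right (hAn _ _) (hx1 _)
  have hSW : ∀ v, ∑ w ∈ W, A v w * x w ≤ dW v := by
    intro v
    rw [hdW]
    exact sum_le_sum fun w _ => mul_le_of_le_one_right (hAn _ _) (hx1 _)
  have hxN : ∀ v ∈ N, lam * x v = 1 + ∑ w ∈ N, A v w * x w + ∑ w ∈ W, A v w * x w := by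
    intro v hv
    rw [hx, hsplit, huN v hv, hu, one_mul]
  have hxW : ∀ v ∈ W, lam * x v = ∑ w ∈ N, A v w * x w + ∑ w ∈ W, A v w * x w := by
    intro v hv
    rw [hx, hsplit, huW v hv, zero_mul, zero_add]
  have hlamS : lam = ∑ v ∈ N, x v := by
    have h1 := hx u
    rw [hsplit, hu, huu] at h1
    have h2 : ∑ v ∈ N, A u v * x v = ∑ v ∈ N, x v :=
      sum_congr rfl fun v hv => by rw [hAs, huN v hv, one_mul]
    have h3 : ∑ v ∈ W, A u v * x v = 0 :=
      sum_eq_zero fun v hv => by rw [hAs, huW v hv, zero_mul]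
    rw [h2, h3] at h1
    linarith
  have hxpos : ∀ v ∈ N, 0 < x v := by
    intro v hv
    have h1 := hxN v hv
    have h2 : 0 ≤ ∑ w ∈ N, A v w * x w := sum_nonneg fun w _ => mul_nonneg (hAn _ _) (hx0 _)
    have h3 : 0 ≤ ∑ w ∈ W, A v w * x w := sum_nonneg fun w _ => mul_nonneg (hAn _ _) (hx0 _)
    by_contra h
    nlinarith
  have hbN : ∀ v ∈ N, 8 * x v ≤ 1 + k v + dW v := by
    intro v hv
    have h1 := hxN v hv
    have h2 := hSN v
    have h3 := hSW v
    nlinarith [hx0 v]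
  have hbW : ∀ v ∈ W, 8 * x v ≤ k v + dW v := by
    intro v hv
    have h1 := hxW v hv
    have h2 := hSN v
    have h3 := hSW v
    nlinarith [hx0 v]
  -- global identities
  have hNW : ∀ f : V → ℝ, ∑ v ∈ N, ∑ w ∈ W, A v w * f w = ∑ w ∈ W, k w * f w := by
    intro f
    rw [sum_comm]
    refine sum_congr rfl fun w _ => ?_
    rw [← sum_mul, ← hkA]
    congr 1
    exact sum_congr rfl fun v _ => hAs _ _
  have hNN : ∑ v ∈ N, ∑ w ∈ N, A v w * x w = ∑ w ∈ N, k w * x w := by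
    rw [sum_comm]
    refine sum_congr rfl fun w _ => ?_
    rw [← sum_mul, ← hkA]
    congr 1
    exact sum_congr rfl fun v _ => hAs _ _
  have hdWk : ∑ v ∈ N, dW v = ∑ w ∈ W, (k w : ℝ) := by
    have := hNW (fun _ => 1)
    simp only [mul_one] at this
    rw [← this]
    exact sum_congr rfl fun v _ => hdW v
  have hl2 : lam ^ 2 = N.card + ∑ v ∈ N, k v * x v + ∑ w ∈ W, k w * x w := by
    calc lam ^ 2 = lam * ∑ v ∈ N, x v := by rw [← hlamS]; ring
      _ = ∑ v ∈ N, (1 + ∑ w ∈ N, A v w * x w + ∑ w ∈ W, A v w * x w) := by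
        rw [mul_sum]; exact sum_congr rfl hxN
      _ = _ := by
        rw [sum_add_distrib, sum_add_distrib, hNN, hNW]; simp
  have h2m' : 2 * m = 2 * N.card + ∑ v ∈ N, (k v : ℝ) + 2 * ∑ w ∈ W, (k w : ℝ)
      + ∑ w ∈ W, dW w := by
    rw [← h2m, hsplit]
    have e1 : ∑ b, A u b = N.card := by
      rw [hsplit, huu, sum_congr rfl (fun v hv => (hAs u v).trans (huN v hv)),
        sum_congr rfl (fun v hv => (hAs u v).trans (huW v hv))]
      simp
    have e2 : ∑ v ∈ N, ∑ b, A v b = ∑ v ∈ N, (1 + (k v : ℝ) + dW v) := by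
      refine sum_congr rfl fun v hv => ?_
      rw [hsplit, huN v hv, hkA, hdW]
    have e3 : ∑ v ∈ W, ∑ b, A v b = ∑ v ∈ W, ((k v : ℝ) + dW v) := by
      refine sum_congr rfl fun v hv => ?_
      rw [hsplit, huW v hv, hkA, hdW, zero_add]
    rw [e1, e2, e3, sum_add_distrib, sum_add_distrib, sum_add_distrib, hdWk]
    simp
    ring
  -- structural facts
  have hbig : ∀ v ∈ N, 4 ≤ k v → ∀ y ∈ N, G.Adj v y → k y = 1 := by
    intro v hv hkv y hy hvy
    have hvmem : v ∈ N.filter (G.Adj y) := by simp [hv, hvy.symm]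
    rw [hk, card_eq_one]
    refine ⟨v, ?_⟩
    ext z
    simp only [mem_singleton]
    constructor
    · intro hz
      by_contra hzv
      rw [mem_filter] at hz
      rw [hk] at hkv
      have hc : 1 < (((N.filter (G.Adj v)).erase y).erase z).card := by
        have h1 := pred_card_le_card_erase (s := N.filter (G.Adj v)) (a := y)
        have h2 := pred_card_le_card_erase (s := (N.filter (G.Adj v)).erase y) (a := z)
        omega
      obtain ⟨c1, hc1, c2, hc2, hne⟩ := one_lt_card.1 hc
      simp only [mem_erase, mem_filter] at hc1 hc2
      refine theta_unpack G hfree u v c1 c2 z y ((hN _).1 hc1.2.2.1) hc1.2.2.2.symm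
        ((hN _).1 hc2.2.2.1) hc2.2.2.2.symm ((hN _).1 hz.1) hz.2.symm hvy.symm
        ((hN _).1 hv).ne hne hc1.1 hc1.2.1 hc2.1 hc2.2.1 ((hN _).1 hy).ne (Ne.symm hzv)
    · rintro rfl; exact hvmem
  have hW3 : ∀ w ∈ W, ∀ v ∈ N, G.Adj w v → 1 ≤ k v → k w ≤ 3 := by
    intro w hw v hv hwv hkv
    by_contra hkw
    rw [hk] at hkv hkw
    obtain ⟨v', hv'⟩ := card_pos.1 hkv
    rw [mem_filter] at hv'
    have hc : 1 < (((N.filter (G.Adj w)).erase v).erase v').card := by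
      have h1 := pred_card_le_card_erase (s := N.filter (G.Adj w)) (a := v)
      have h2 := pred_card_le_card_erase (s := (N.filter (G.Adj w)).erase v) (a := v')
      omega
    obtain ⟨c1, hc1, c2, hc2, hne⟩ := one_lt_card.1 hc
    simp only [mem_erase, mem_filter] at hc1 hc2
    have hw' := (hW w).1 hw
    refine theta_unpack G hfree w u c1 c2 v v' hc1.2.2.2 ((hN _).1 hc1.2.2.1).symm
      hc2.2.2.2 ((hN _).1 hc2.2.2.1).symm hwv hv'.2 ((hN _).1 hv'.1).symm hw'.1 hne hc1.2.1 hc1.1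
      hc2.2.1 hc2.1 ?_ ((hN _).1 hv).ne
    rintro rfl
    exact hw'.2 ((hN _).1 hv'.1)
  -- costs
  obtain ⟨φ, hφ⟩ : ∃ φ : V → V → ℝ, ∀ v w, φ v w =
      if 4 ≤ k v then 1 else if 4 ≤ k w then 0 else 1 / 2 := ⟨_, fun _ _ => rfl⟩
  obtain ⟨cost, hcost⟩ : ∃ cost : V → ℝ, ∀ v, cost v = ∑ w ∈ N, A v w * φ v w :=
    ⟨_, fun _ => rfl⟩
  have hcostsum : 2 * ∑ v ∈ N, cost v = ∑ v ∈ N, (k v : ℝ) := by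
    have e1 : ∑ v ∈ N, cost v = ∑ v ∈ N, ∑ w ∈ N, A v w * φ v w :=
      sum_congr rfl fun v _ => hcost v
    have e2 : ∑ v ∈ N, cost v = ∑ v ∈ N, ∑ w ∈ N, A v w * φ w v := by
      rw [e1, sum_comm]
      exact sum_congr rfl fun v _ => sum_congr rfl fun w _ => by rw [hAs]
    rw [two_mul]
    nth_rewrite 1 [e1]
    rw [e2, ← sum_add_distrib]
    refine sum_congr rfl fun v hv => ?_
    rw [← sum_add_distrib, ← hkA]
    refine sum_congr rfl fun w hw => ?_
    by_cases h : G.Adj v w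
    · rw [hφ, hφ]
      by_cases h1 : 4 ≤ k v
      · have h2 := hbig v hv h1 w hw h
        simp [h1, h2]
      · by_cases h2 : 4 ≤ k w
        · simp [h1, h2]
        · simp [h1, h2]; ring
    · simp [hA0 _ _ h]
  -- `r w`
  have hr : ∀ w ∈ W, 5 / 8 * ∑ v ∈ N, A w v * (if 1 ≤ k v then 1 else 0)
      ≤ k w * (1 - x w) + dW w / 2 := by
    intro w hw
    by_cases hex : ∃ v ∈ N, G.Adj w v ∧ 1 ≤ k v
    · obtain ⟨v, hv, hwv, hkv⟩ := hex
      have h3 : (k w : ℝ) ≤ 3 := by exact_mod_cast hW3 w hw v hv hwv hkv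
      have h4 : ∑ v ∈ N, A w v * (if 1 ≤ k v then (1 : ℝ) else 0) ≤ k w := by
        rw [← hkA]
        refine sum_le_sum fun v _ => mul_le_of_le_one_right (hAn _ _) ?_
        split_ifs <;> norm_num
      have h5 := hbW w hw
      have h6 : (0 : ℝ) ≤ k w := Nat.cast_nonneg _
      have h7 := hdW0 w
      nlinarith [mul_le_mul_of_nonneg_left h5 h6, mul_nonneg h6 (sub_nonneg.2 h3),
        mul_nonneg h7 (sub_nonneg.2 h3)]
    · push Not at hex
      rw [sum_eq_zero]
      · have h1 := hx1 w
        have h6 : (0 : ℝ) ≤ k w := Nat.cast_nonneg _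
        have h7 := hdW0 w
        nlinarith [mul_nonneg h6 (sub_nonneg.2 h1)]
      · intro v hv
        by_cases h : G.Adj w v
        · have := hex v hv h
          rw [if_neg (by omega), mul_zero]
        · rw [hA0 _ _ h, zero_mul]
  obtain ⟨q, hq⟩ : ∃ q : V → ℝ, ∀ v, q v = (if 1 ≤ k v then dW v else 0) := ⟨_, fun _ => rfl⟩
  have hrsum : 5 / 8 * ∑ v ∈ N, q v ≤ ∑ w ∈ W, (k w * (1 - x w) + dW w / 2) := by
    refine le_trans (le_of_eq ?_) (sum_le_sum hr)
    rw [← mul_sum, sum_comm]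
    congr 1
    refine sum_congr rfl fun v _ => ?_
    rw [← sum_mul, hq, hdW, sum_congr rfl (fun w _ => hAs w v)]
    split_ifs <;> simp
  have hmain : 1 + ∑ v ∈ N, (((k v : ℝ) - 1) * x v - cost v)
      = ∑ w ∈ W, (k w * (1 - x w) + dW w / 2) := by
    have e1 : ∑ v ∈ N, (((k v : ℝ) - 1) * x v - cost v)
        = ∑ v ∈ N, (k v : ℝ) * x v - ∑ v ∈ N, x v - ∑ v ∈ N, cost v := by
      rw [← sum_sub_distrib, ← sum_sub_distrib]
      exact sum_congr rfl fun v _ => by ring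
    have e2 : ∑ w ∈ W, (k w * (1 - x w) + dW w / 2)
        = ∑ w ∈ W, (k w : ℝ) - ∑ w ∈ W, (k w : ℝ) * x w + (∑ w ∈ W, dW w) / 2 := by
      rw [sum_div, ← sum_sub_distrib, ← sum_add_distrib]
      exact sum_congr rfl fun v _ => by ring
    rw [e1, e2, ← hlamS]
    linarith
  obtain ⟨h, hh⟩ : ∃ h : V → ℝ, ∀ v, h v = ((k v : ℝ) - 1) * x v - cost v - 5 / 8 * q v :=
    ⟨_, fun _ => rfl⟩
  have hhsum : ∑ v ∈ N, (((k v : ℝ) - 1) * x v - cost v) = ∑ v ∈ N, h v + 5 / 8 * ∑ v ∈ N, q v := by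
    rw [mul_sum, ← sum_add_distrib]
    exact sum_congr rfl fun v _ => by rw [hh]; ring
  have hE : 0 ≤ 1 + ∑ v ∈ N, h v := by linarith
  -- local bounds on `h`
  have hcb : ∀ v, 4 ≤ k v → h v ≤ -1 - 5 / 8 * dW v := by
    intro v hv
    have h1 : cost v = k v := by
      rw [hcost, ← hkA]
      exact sum_congr rfl fun w _ => by rw [hφ, if_pos hv, mul_one]
    rw [hh, h1, hq, if_pos (by omega)]
    have h2 : (4 : ℝ) ≤ k v := by exact_mod_cast hv
    nlinarith [hx1 v]
  have hcl : ∀ v ∈ N, ∀ b ∈ N, G.Adj b v → 4 ≤ k b → h v = - (5 / 8 * dW v) := by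
    intro v hv b hb hbv hkb
    have h1 := hbig b hb hkb v hv hbv
    have h2 : cost v = 0 := by
      have h3 : N.filter (G.Adj v) = {b} := by
        have h4 := hk v
        rw [h1] at h4
        obtain ⟨b', hb'⟩ := card_eq_one.1 h4.symm
        have : b ∈ N.filter (G.Adj v) := by simp [hb, hbv.symm]
        rw [hb'] at this ⊢
        rw [mem_singleton.1 this]
      rw [hcost]
      refine sum_eq_zero fun w hw => ?_
      by_cases hvw : G.Adj v w
      · have : w ∈ N.filter (G.Adj v) := by simp [hw, hvw]
        rw [h3, mem_singleton] at this
        rw [hφ, if_neg (by omega), this, if_pos hkb, mul_zero]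
      · rw [hA0 _ _ hvw, zero_mul]
    rw [hh, h1, h2, hq, if_pos (by omega)]
    simp
  have hco : ∀ v ∈ N, ¬ 4 ≤ k v → (∀ b ∈ N, G.Adj b v → ¬ 4 ≤ k b) → h v ≤ - (x v / 2) := by
    intro v hv hkv hb
    have h1 : cost v = k v / 2 := by
      rw [hcost, ← hkA, sum_div]
      refine sum_congr rfl fun w hw => ?_
      by_cases hvw : G.Adj v w
      · rw [hφ, if_neg hkv, if_neg (hb w hw hvw.symm)]; ring
      · rw [hA0 _ _ hvw]; simp
    have h2 := hbN v hv
    have h3 := hx1 v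
    have h4 := hdW0 v
    have h5 := hx0 v
    rw [hh, h1, hq]
    have hk4 : k v < 4 := by omega
    generalize k v = n at *
    interval_cases n
    · norm_num; linarith
    · norm_num; linarith
    · norm_num at *; linarith
    · norm_num at *; linarith
  have hle : ∀ v ∈ N, h v ≤ 0 := by
    intro v hv
    by_cases h1 : 4 ≤ k v
    · have := hcb v h1
      linarith [hdW0 v]
    by_cases h2 : ∃ b ∈ N, G.Adj b v ∧ 4 ≤ k b
    · obtain ⟨b, hb, hbv, hkb⟩ := h2
      rw [hcl v hv b hb hbv hkb]
      linarith [hdW0 v]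
    · push Not at h2
      have := hco v hv h1 (fun b hb hbv => by have := h2 b hb hbv; omega)
      linarith [hx0 v]
  obtain ⟨c, hc, hkc⟩ : ∃ c ∈ N, 4 ≤ k c := by
    by_contra hno
    push Not at hno
    have h1 : ∑ v ∈ N, h v ≤ ∑ v ∈ N, -(x v / 2) :=
      sum_le_sum fun v hv => hco v hv (by have := hno v hv; omega)
        (fun b hb _ => by have := hno b hb; omega)
    rw [sum_neg_distrib, ← sum_div, ← hlamS] at h1
    linarith
  have hcs : ∑ v ∈ N, h v = h c + ∑ v ∈ N.erase c, h v := (add_sum_erase N h hc).symm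
  have hce : ∀ v ∈ N.erase c, h v ≤ 0 := fun v hv => hle v (mem_of_mem_erase hv)
  have hce0 : ∑ v ∈ N.erase c, h v ≤ 0 := sum_nonpos hce
  have hcc := hcb c hkc
  have hdc := hdW0 c
  have hz : ∀ v ∈ N.erase c, h v = 0 := by
    refine (sum_eq_zero_iff_of_nonpos hce).1 ?_
    linarith
  have hleaf : ∀ v ∈ N, v ≠ c → G.Adj c v ∧ dW v = 0 := by
    intro v hv hvc
    have h0 := hz v (mem_erase.2 ⟨hvc, hv⟩)
    by_cases h1 : 4 ≤ k v
    · have := hcb v h1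
      linarith [hdW0 v]
    by_cases h2 : ∃ b ∈ N, G.Adj b v ∧ 4 ≤ k b
    · obtain ⟨b, hb, hbv, hkb⟩ := h2
      have h3 := hcl v hv b hb hbv hkb
      by_cases hbc : b = c
      · subst hbc
        exact ⟨hbv, by linarith⟩
      · have := hz b (mem_erase.2 ⟨hbc, hb⟩)
        have := hcb b hkb
        linarith [hdW0 b]
    · push Not at h2
      have := hco v hv h1 (fun b hb hbv => by have := h2 b hb hbv; omega)
      linarith [hxpos v hv]
  have hdWN : ∀ v ∈ N, dW v = 0 := by
    intro v hv
    by_cases hvc : v = c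
    · subst hvc; linarith
    · exact (hleaf v hv hvc).2
  have hkW : ∑ w ∈ W, (k w : ℝ) = 0 := by rw [← hdWk]; exact sum_eq_zero hdWN
  have hkW0 : ∀ w ∈ W, (k w : ℝ) = 0 :=
    (sum_eq_zero_iff_of_nonneg fun w _ => Nat.cast_nonneg _).1 hkW
  have hqN : ∑ v ∈ N, q v = 0 := sum_eq_zero fun v hv => by rw [hq, hdWN v hv]; simp
  have hdWW : ∑ w ∈ W, dW w / 2 = 0 := by
    apply le_antisymm
    · have e : ∑ w ∈ W, dW w / 2 = ∑ w ∈ W, (k w * (1 - x w) + dW w / 2) :=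
        sum_congr rfl fun w hw => by rw [hkW0 w hw]; ring
      rw [e, ← hmain, hhsum, hqN]
      linarith
    · exact sum_nonneg fun w _ => by linarith [hdW0 w]
  have hdWW0 := (sum_eq_zero_iff_of_nonneg
    (fun w _ => by linarith [hdW0 w] : ∀ w ∈ W, 0 ≤ dW w / 2)).1 hdWW
  have hWe : ∀ w, w ∉ W := by
    intro w hw
    obtain ⟨y, hy⟩ := hiso w
    have h1 : ∑ b, A w b = 0 := by
      rw [hsplit, huW w hw, hkA, ← hdW, hkW0 w hw]
      linarith [hdWW0 w hw]
    have h2 := (sum_eq_zero_iff_of_nonneg (fun b _ => hAn w b)).1 h1 y (mem_univ _)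
    rw [hA1 _ _ hy] at h2
    norm_num at h2
  have hall : ∀ v, v ≠ u → G.Adj u v := by
    intro v hv
    by_contra hn
    exact hWe v ((hW v).2 ⟨hv, hn⟩)
  have huc : G.Adj u c := (hN c).1 hc
  have hk1 : ∀ v ∈ N, v ≠ c → k v = 1 := fun v hv hvc => hbig c hc hkc v hv (hleaf v hv hvc).1
  have hWem : W = ∅ := eq_empty_of_forall_notMem hWe
  have hcardN : (Fintype.card V : ℝ) = N.card + 1 := by
    have := hsplit (fun _ => 1)
    rw [hWem] at this
    simp at this
    linarith
  have hNe : ((N.erase c).card : ℝ) = N.card - 1 := by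
    rw [card_erase_of_mem hc, Nat.cast_sub (card_pos.2 ⟨c, hc⟩)]; simp
  refine ⟨c, huc.ne, hall, ?_, ?_, ?_⟩
  · intro v hv
    by_cases hvu : v = u
    · rw [hvu]; exact huc.symm
    · exact (hleaf v ((hN v).2 (hall v hvu)) hv).1
  · intro v w hvu hvc hwu hwc hvw
    have hv := (hN v).2 (hall v hvu)
    have hw := (hN w).2 (hall w hwu)
    have h1 := hk1 v hv hvc
    rw [hk] at h1
    have : 1 < (N.filter (G.Adj v)).card :=
      one_lt_card.2 ⟨c, by simp [hc, (hleaf v hv hvc).1.symm], w, by simp [hw, hvw], hwc.symm⟩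
    omega
  · have e1 : ∑ v ∈ N, (k v : ℝ) = k c + (N.card - 1) := by
      rw [← add_sum_erase N _ hc, ← hNe]
      congr 1
      rw [sum_congr rfl (fun v hv => by
        rw [hk1 v (mem_of_mem_erase hv) (ne_of_mem_erase hv)] : ∀ v ∈ N.erase c, (k v : ℝ) = (1 : ℕ))]
      simp
    have e2 : (k c : ℝ) = N.card - 1 := by
      rw [← hkA, ← add_sum_erase N _ hc, hA0 c c (G.loopless.irrefl c), ← hNe,
        sum_congr rfl (fun v hv => hA1 _ _
          (hleaf v (mem_of_mem_erase hv) (ne_of_mem_erase hv)).1)]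
      simp
    rw [e1, e2, hWem] at h2m'
    simp at h2m'
    rw [hcardN]
    linarith

theorem stmt1 {V : Type*} [Fintype V] (G : SimpleGraph V) (m : ℕ)
    (hm : G.edgeSet.ncard = m) (hm57 : 57 ≤ m)
    (hfree : ¬ Contains theta223 G)
    (hiso : ∀ v : V, ∃ w, G.Adj v w)
    (lam : ℝ) (hlam : IsSpectralRadius G lam) :
    lam = (1 + Real.sqrt (4 * (m : ℝ) - 3)) / 2 ↔
      ∃ k : ℕ, m = 2 * k + 1 ∧ Nonempty (G ≃g K2JoinEmpty k) := by
  classical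
  have hmR : (57 : ℝ) ≤ m := by exact_mod_cast hm57
  have hs0 : 0 ≤ Real.sqrt (4 * (m : ℝ) - 3) := Real.sqrt_nonneg _
  have hs2 : Real.sqrt (4 * (m : ℝ) - 3) ^ 2 = 4 * (m : ℝ) - 3 := Real.sq_sqrt (by linarith)
  constructor
  · intro hl
    have hlm : lam ^ 2 - lam = m - 1 := by rw [hl]; nlinarith
    have hl8 : 8 ≤ lam := by
      have : 15 ≤ Real.sqrt (4 * (m : ℝ) - 3) := Real.le_sqrt_of_sq_le (by linarith)
      rw [hl]; linarith
    obtain ⟨y, hy0, hyn, hy⟩ := exists_nonneg_eigvec G lam hlam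
    obtain ⟨i, hi⟩ := Function.ne_iff.1 hy0
    have : Nonempty V := ⟨i⟩
    obtain ⟨u, hu⟩ := Finite.exists_max y
    have hyu : 0 < y u := lt_of_lt_of_le (lt_of_le_of_ne (hyn i) (Ne.symm hi)) (hu i)
    have h2m : ∑ a, ∑ b, (adjMat G) a b = 2 * (m : ℝ) := by
      have h1 : ∀ a, ∑ b, (adjMat G) a b = (G.degree a : ℝ) := by
        intro a
        simp [adjMat, ← SimpleGraph.card_neighborFinset_eq_degree,
          SimpleGraph.neighborFinset_eq_filter]
      rw [Finset.sum_congr rfl (fun a _ => h1 a), ← Nat.cast_sum,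
        G.sum_degrees_eq_twice_card_edges, ← hm, Set.ncard_eq_toFinset_card',
        SimpleGraph.edgeFinset]
      push_cast
      rfl
    obtain ⟨c, huc, h1, h2, h3, h4⟩ := hard_core G hfree hiso (fun a b => adjMat G a b)
      (fun a b h => by simp [adjMat, h]) (fun a b h => by simp [adjMat, h]) m lam h2m hlm hl8
      (fun v => y v / y u) (fun v => div_nonneg (hyn v) hyu.le)
      (fun v => (div_le_one hyu).2 (hu v))
      (fun v => by
        have := congrFun hy v
        simp only [Matrix.mulVec, dotProduct, Pi.smul_apply, smul_eq_mul] at this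
        rw [← mul_div_assoc, ← this, Finset.sum_div]
        exact Finset.sum_congr rfl fun w _ => by ring) u (div_self hyu.ne')
    have hcard : 2 ≤ Fintype.card V := by
      have := Finset.card_le_univ ({u, c} : Finset V)
      rwa [Finset.card_pair huc] at this
    refine ⟨Fintype.card V - 2, ?_, iso_of_struct G u c huc h1 h2 h3 _ (by omega)⟩
    have h5 : (m : ℝ) = ((2 * (Fintype.card V - 2) + 1 : ℕ) : ℝ) := by
      push_cast [Nat.cast_sub hcard]
      exact h4
    exact_mod_cast h5
  · rintro ⟨k, hk, ⟨e⟩⟩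
    refine easy_dir G k lam hlam e _ (by linarith) ?_
    have : (m : ℝ) = 2 * k + 1 := by exact_mod_cast hk
    nlinarith
end

section
/- Let m ≥ 57 and let G* attain the maximum spectral radius among all θ_{2,2,3}-free graphs with m edges and no isolated vertices. Let x be a positive eigenvector of the adjacency matrix of G* corresponding to λ(G*), let u* be a vertex maximizing the entries of x, and set U = N(u*). Then the induced subgraph G*[U] contains no cycle of length at least four. -/
open SimpleGraph

/-- Bundled Contains constructor. -/
lemma contains_theta {V : Type*} (G : SimpleGraph V) (a b c1 c2 d1 d2 : V)
    (hnd : [a, b, c1, c2, d1, d2].Nodup)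
    (h1 : G.Adj a c1) (h2 : G.Adj c1 b) (h3 : G.Adj a c2) (h4 : G.Adj c2 b)
    (h5 : G.Adj a d1) (h6 : G.Adj d1 d2) (h7 : G.Adj d2 b) : Contains theta223 G := by
  refine ⟨⟨fun i => [a, b, c1, c2, d1, d2].get i, List.nodup_iff_injective_get.1 hnd⟩, ?_⟩
  intro i j hij
  simp only [theta223, SimpleGraph.fromRel_adj] at hij
  obtain ⟨_, h | h⟩ := hij <;>
  rcases h with ⟨rfl, rfl⟩ | ⟨rfl, rfl⟩ | ⟨rfl, rfl⟩ | ⟨rfl, rfl⟩ | ⟨rfl, rfl⟩ | ⟨rfl, rfl⟩ | ⟨rfl, rfl⟩ <;>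
  first
  | assumption
  | (apply SimpleGraph.Adj.symm; assumption)

lemma exists_not_mem_of_card {V : Type*} [DecidableEq V] (s t : Finset V) (h : t.card < s.card) :
    ∃ y ∈ s, y ∉ t := by
  by_contra hc
  push Not at hc
  exact absurd (Finset.card_le_card (fun y hy => hc y hy)) (by omega)

open Classical in
/-- A vertex of `U` with at least four neighbours in `U` has only leaf neighbours there. -/
lemma theta_L1 {V : Type*} [Fintype V] (G : SimpleGraph V) (hfree : ¬ Contains theta223 G)
    (u v n z : V) (hv : G.Adj u v) (hn : G.Adj u n) (hz : G.Adj u z)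
    (hvn : G.Adj v n) (hnz : G.Adj n z) (hzv : z ≠ v) :
    ((Finset.univ.filter (G.Adj u)).filter (G.Adj v)).card ≤ 3 := by
  by_contra hc
  push Not at hc
  set S := (Finset.univ.filter (G.Adj u)).filter (G.Adj v)
  obtain ⟨p, hp, hp'⟩ := exists_not_mem_of_card S {n, z}
    (lt_of_le_of_lt Finset.card_le_two (by omega))
  obtain ⟨q, hq, hq'⟩ := exists_not_mem_of_card S {n, z, p}
    (lt_of_le_of_lt Finset.card_le_three (by omega))
  simp only [S, Finset.mem_filter, Finset.mem_univ, true_and, Finset.mem_insert,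
    Finset.mem_singleton, not_or] at hp hp' hq hq'
  refine hfree (contains_theta G u v p q z n ?_ hp.1 hp.2.symm hq.1 hq.2.symm hz hnz.symm hvn.symm)
  have := hp.1.ne; have := hp.2.ne; have := hq.1.ne; have := hq.2.ne
  have := hv.ne; have := hn.ne; have := hz.ne; have := hvn.ne; have := hnz.ne
  simp only [List.nodup_cons, List.mem_cons, List.not_mem_nil, or_false, not_or, not_false_eq_true,
    List.nodup_nil, and_true]
  grind

open Classical in
lemma theta_L2 {V : Type*} [Fintype V] (G : SimpleGraph V) (hfree : ¬ Contains theta223 G)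
    (u v w : V) (hv : G.Adj u v) (hw : ¬ G.Adj u w) (hwu : w ≠ u) (hvw : G.Adj v w)
    (h2 : 2 ≤ ((Finset.univ.filter (G.Adj u)).filter (G.Adj v)).card) :
    ((Finset.univ.filter (G.Adj u)).filter (G.Adj w)).card ≤ 3 := by
  by_contra hc
  push Not at hc
  obtain ⟨p, hp, q, hq, hpq⟩ := Finset.one_lt_card.1 (show 1 < _ from h2)
  obtain ⟨y, hy, hy'⟩ := exists_not_mem_of_card
    ((Finset.univ.filter (G.Adj u)).filter (G.Adj w)) {v, p, q}
    (lt_of_le_of_lt Finset.card_le_three (by omega))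
  simp only [Finset.mem_filter, Finset.mem_univ, true_and, Finset.mem_insert,
    Finset.mem_singleton, not_or] at hp hq hy hy'
  refine hfree (contains_theta G v u p q w y ?_ hp.2 hp.1.symm hq.2 hq.1.symm hvw hy.2 hy.1.symm)
  have := hp.1.ne; have := hp.2.ne; have := hq.1.ne; have := hq.2.ne
  have := hv.ne; have := hy.1.ne; have := hy.2.ne; have := hvw.ne
  have : p ≠ w := fun h => hw (h ▸ hp.1)
  have : q ≠ w := fun h => hw (h ▸ hq.1)
  simp only [List.nodup_cons, List.mem_cons, List.not_mem_nil, or_false, not_or, not_false_eq_true,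
    List.nodup_nil, and_true]
  grind

open Classical in
lemma core {V : Type*} [Fintype V] (G : SimpleGraph V) (hfree : ¬ Contains theta223 G)
    (m lam : ℝ) (hlam : 8 ≤ lam) (hlm : m - 2 ≤ lam ^ 2 - lam)
    (x : V → ℝ) (hx : ∀ v, 0 < x v) (hx1 : ∀ v, x v ≤ 1)
    (heig : ∀ v, ∑ w, (if G.Adj v w then x w else 0) = lam * x v)
    (hm : 2 * m = ∑ v, ∑ w, (if G.Adj v w then (1 : ℝ) else 0))
    (u : V) (hu : x u = 1)
    (y1 v1 v2 v3 v4 y4 : V) (hy1 : G.Adj u y1) (hv1 : G.Adj u v1) (hv2 : G.Adj u v2)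
    (hv3 : G.Adj u v3) (hv4 : G.Adj u v4) (hy4 : G.Adj u y4)
    (a01 : G.Adj y1 v1) (a12 : G.Adj v1 v2) (a23 : G.Adj v2 v3) (a34 : G.Adj v3 v4)
    (a45 : G.Adj v4 y4) (n13 : v1 ≠ v3) (n14 : v1 ≠ v4) (n24 : v2 ≠ v4)
    (n02 : y1 ≠ v2) (n35 : v3 ≠ y4) : False := by
  set U : Finset V := Finset.univ.filter (G.Adj u) with hU
  set W : Finset V := Finset.univ.filter (fun w => w ≠ u ∧ ¬ G.Adj u w) with hW
  have memU : ∀ v, v ∈ U ↔ G.Adj u v := by simp [hU]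
  have memW : ∀ v, v ∈ W ↔ (v ≠ u ∧ ¬ G.Adj u v) := by simp [hW]
  -- splitting sums
  have split : ∀ F : V → ℝ, ∑ z, F z = F u + ∑ z ∈ U, F z + ∑ z ∈ W, F z := by
    intro F
    have huniv : (Finset.univ : Finset V) = ({u} ∪ U) ∪ W := by
      ext z
      simp only [Finset.mem_univ, Finset.mem_union, Finset.mem_singleton, memU, memW, true_iff]
      tauto
    have d1 : Disjoint ({u} : Finset V) U := by
      rw [Finset.disjoint_left]
      intro z hz hz'
      rw [Finset.mem_singleton] at hz
      subst hz
      exact G.irrefl ((memU _).1 hz')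
    have d2 : Disjoint (({u} : Finset V) ∪ U) W := by
      rw [Finset.disjoint_left]
      intro z hz hz'
      rw [memW] at hz'
      rw [Finset.mem_union, Finset.mem_singleton, memU] at hz
      tauto
    rw [huniv, Finset.sum_union d2, Finset.sum_union d1, Finset.sum_singleton]
  let d : V → ℕ := fun v => (U.filter (G.Adj v)).card
  let e : V → ℝ := fun v => ∑ w ∈ W, if G.Adj v w then (1 : ℝ) else 0
  let s : V → ℝ := fun v => ∑ w ∈ W, if G.Adj v w then x w else 0
  let l : V → ℝ := fun v => ∑ z ∈ U, if G.Adj v z ∧ d z = 1 then (1 : ℝ) else 0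
  have dsum : ∀ v, (d v : ℝ) = ∑ z ∈ U, if G.Adj v z then (1 : ℝ) else 0 := by
    intro v
    simp [d, Finset.sum_boole]
  have s0 : ∀ v, 0 ≤ s v := fun v => Finset.sum_nonneg fun w _ => by
    split_ifs
    · exact (hx w).le
    · exact le_rfl
  have e0 : ∀ v, 0 ≤ e v := fun v => Finset.sum_nonneg fun w _ => by split_ifs <;> norm_num
  have l0 : ∀ v, 0 ≤ l v := fun v => Finset.sum_nonneg fun w _ => by split_ifs <;> norm_num
  -- eigen equations
  have eigU : ∀ v ∈ U, lam * x v = 1 + (∑ z ∈ U, if G.Adj v z then x z else 0) + s v := by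
    intro v hv
    rw [← heig v, split, if_pos ((memU v).1 hv).symm, hu]
  have eigu : lam = ∑ v ∈ U, x v := by
    have h := heig u
    rw [split, if_neg G.irrefl, hu] at h
    have h1 : (∑ z ∈ U, if G.Adj u z then x z else 0) = ∑ v ∈ U, x v :=
      Finset.sum_congr rfl fun z hz => if_pos ((memU z).1 hz)
    have h2 : (∑ z ∈ W, if G.Adj u z then x z else 0) = 0 :=
      Finset.sum_eq_zero fun z hz => if_neg ((memW z).1 hz).2
    linarith
  have swapUU : ∑ v ∈ U, (∑ z ∈ U, if G.Adj v z then x z else 0) = ∑ z ∈ U, (d z : ℝ) * x z := by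
    rw [Finset.sum_comm]
    refine Finset.sum_congr rfl fun z _ => ?_
    rw [dsum, Finset.sum_mul]
    refine Finset.sum_congr rfl fun v _ => ?_
    simp [G.adj_comm]
  have swapUW : ∑ v ∈ U, s v = ∑ w ∈ W, (d w : ℝ) * x w := by
    show ∑ v ∈ U, ∑ w ∈ W, _ = _
    rw [Finset.sum_comm]
    refine Finset.sum_congr rfl fun z _ => ?_
    rw [dsum, Finset.sum_mul]
    refine Finset.sum_congr rfl fun v _ => ?_
    simp [G.adj_comm]
  have swape : ∑ v ∈ U, e v = ∑ w ∈ W, (d w : ℝ) := by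
    show ∑ v ∈ U, ∑ w ∈ W, _ = _
    rw [Finset.sum_comm]
    refine Finset.sum_congr rfl fun z _ => ?_
    rw [dsum]
    refine Finset.sum_congr rfl fun v _ => ?_
    simp [G.adj_comm]
  have lam2 : lam ^ 2 = (U.card : ℝ) + ∑ z ∈ U, (d z : ℝ) * x z + ∑ w ∈ W, (d w : ℝ) * x w := by
    have : lam ^ 2 = ∑ v ∈ U, lam * x v := by
      rw [← Finset.mul_sum, ← eigu]; ring
    rw [this, Finset.sum_congr rfl eigU, Finset.sum_add_distrib, Finset.sum_add_distrib,
      swapUU, swapUW]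
    simp
  have m2 : 2 * m = 2 * (U.card : ℝ) + ∑ v ∈ U, (d v : ℝ) + 2 * ∑ w ∈ W, (d w : ℝ)
      + ∑ w ∈ W, e w := by
    rw [hm, split]
    have h1 : (∑ w, if G.Adj u w then (1 : ℝ) else 0) = U.card := by
      simp [hU, Finset.sum_boole]
    have h2 : ∑ v ∈ U, (∑ w, if G.Adj v w then (1 : ℝ) else 0)
        = ∑ v ∈ U, (1 + (d v : ℝ) + e v) := by
      refine Finset.sum_congr rfl fun v hv => ?_
      rw [split, if_pos ((memU v).1 hv).symm, dsum]
    have h3 : ∑ v ∈ W, (∑ w, if G.Adj v w then (1 : ℝ) else 0)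
        = ∑ v ∈ W, ((d v : ℝ) + e v) := by
      refine Finset.sum_congr rfl fun v hv => ?_
      rw [split, if_neg (fun h => ((memW v).1 hv).2 h.symm), dsum, zero_add]
    rw [h1, h2, h3]
    simp only [Finset.sum_add_distrib, swape]
    simp
    ring
  -- local bounds
  have eig8 : ∀ v ∈ U, 8 * x v ≤ 1 + (∑ z ∈ U, if G.Adj v z then x z else 0) + s v := by
    intro v hv
    rw [← eigU v hv]
    exact mul_le_mul_of_nonneg_right hlam (hx v).le
  have eigd : ∀ v ∈ U, 8 * x v ≤ 1 + d v + s v := by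
    intro v hv
    have h := eig8 v hv
    have h' : (∑ z ∈ U, if G.Adj v z then x z else 0) ≤ d v := by
      rw [dsum]
      refine Finset.sum_le_sum fun z _ => ?_
      split_ifs
      · exact hx1 z
      · exact le_rfl
    linarith
  have eigp : ∀ v ∈ U, ∀ z ∈ U, G.Adj v z → 8 * x v ≤ d v + x z + s v := by
    intro v hv z hz hvz
    have h := eig8 v hv
    have h' : (∑ z ∈ U, if G.Adj v z then x z else 0) ≤ d v - 1 + x z := by
      rw [dsum, ← Finset.add_sum_erase U _ hz, ← Finset.add_sum_erase U _ hz, if_pos hvz,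
        if_pos hvz]
      have : (∑ z ∈ U.erase z, if G.Adj v z then x z else 0) ≤
          ∑ z ∈ U.erase z, if G.Adj v z then (1 : ℝ) else 0 := by
        refine Finset.sum_le_sum fun z _ => ?_
        split_ifs
        · exact hx1 z
        · exact le_rfl
      linarith
    linarith
  have eigW : ∀ w ∈ W, 8 * x w ≤ d w + e w := by
    intro w hw
    have h := heig w
    have h8 : 8 * x w ≤ lam * x w := mul_le_mul_of_nonneg_right hlam (hx w).le
    rw [← h, split, if_neg (fun h => ((memW w).1 hw).2 h.symm), zero_add] at h8
    refine h8.trans (add_le_add ?_ ?_)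
    · rw [dsum]
      refine Finset.sum_le_sum fun z _ => ?_
      split_ifs
      · exact hx1 z
      · exact le_rfl
    · refine Finset.sum_le_sum fun z _ => ?_
      split_ifs
      · exact hx1 z
      · exact le_rfl
  -- the discharged function
  let s' : V → ℝ := fun v => if 2 ≤ d v then s v else 0
  let f : V → ℝ := fun v => ((d v : ℝ) - 1) * x v - d v / 2 - l v / 2 + (if d v = 1 then 1 / 2 else 0)
  let g : V → ℝ := fun v => f v - 2 / 5 * s' v
  have suml : ∑ v ∈ U, l v = ∑ v ∈ U, if d v = 1 then (1 : ℝ) else 0 := by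
    show ∑ v ∈ U, ∑ w ∈ U, _ = _
    rw [Finset.sum_comm]
    refine Finset.sum_congr rfl fun z _ => ?_
    by_cases hz : d z = 1
    · have := dsum z
      rw [hz] at this
      simp only [hz, and_true, if_true]
      rw [Nat.cast_one] at this
      refine Eq.trans ?_ this.symm
      refine Finset.sum_congr rfl fun v _ => ?_
      simp [G.adj_comm]
    · simp [hz]
  have sumf : ∑ v ∈ U, f v = ∑ v ∈ U, (d v : ℝ) * x v - lam - (∑ v ∈ U, (d v : ℝ)) / 2 := by
    have : ∀ v, f v = (d v : ℝ) * x v - x v - (d v : ℝ) / 2 - l v / 2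
        + (if d v = 1 then (1 : ℝ) else 0) / 2 := by
      intro v
      show ((d v : ℝ) - 1) * x v - d v / 2 - l v / 2 + (if d v = 1 then 1 / 2 else 0) = _
      split_ifs <;> ring
    simp only [this, Finset.sum_add_distrib, Finset.sum_sub_distrib, ← Finset.sum_div, suml, ← eigu]
    ring
  have g0 : ∀ v ∈ U, g v ≤ 0 := by
    intro v hv
    have hxv := hx v
    have hx1v := hx1 v
    have hl := l0 v
    have hs := s0 v
    have hd := eigd v hv
    show ((d v : ℝ) - 1) * x v - d v / 2 - l v / 2 + (if d v = 1 then 1 / 2 else 0)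
      - 2 / 5 * (if 2 ≤ d v then s v else 0) ≤ 0
    rcases lt_or_ge (d v) 4 with h4 | h4
    · interval_cases hdv : d v
      · norm_num; linarith
      · norm_num; linarith
      · norm_num; linarith
      · norm_num at hd ⊢; linarith
    · have hleaf : ∀ n ∈ U, G.Adj v n → d n = 1 := by
        intro n hn hvn
        have hpos : v ∈ U.filter (G.Adj n) := Finset.mem_filter.2 ⟨hv, hvn.symm⟩
        by_contra hne
        have : 1 < d n := by
          have : 0 < d n := Finset.card_pos.2 ⟨v, hpos⟩
          omega
        obtain ⟨z, hz, hz'⟩ := exists_not_mem_of_card (U.filter (G.Adj n)) {v} (by simpa using this)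
        rw [Finset.mem_filter] at hz
        have := theta_L1 G hfree u v n z ((memU _).1 hv) ((memU _).1 hn) ((memU _).1 hz.1) hvn hz.2
          (by simpa using hz')
        exact absurd this (not_le.2 h4)
      have hld : l v = d v := by
        rw [dsum]
        refine Finset.sum_congr rfl fun z hz => ?_
        by_cases h : G.Adj v z
        · simp [h, hleaf z hz h]
        · simp [h]
      rw [hld, if_neg (by omega), if_pos (by omega)]
      have h4' : (4 : ℝ) ≤ d v := by exact_mod_cast h4
      nlinarith
  have d2 : ∀ v ∈ U, ∀ p ∈ U, ∀ q ∈ U, p ≠ q → G.Adj v p → G.Adj v q → 2 ≤ d v := by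
    intro v _ p hp q hq hpq h1 h2
    exact Finset.one_lt_card.2 ⟨p, Finset.mem_filter.2 ⟨hp, h1⟩, q, Finset.mem_filter.2 ⟨hq, h2⟩, hpq⟩
  have pair : ∀ v ∈ U, ∀ z ∈ U, G.Adj v z → 2 ≤ d v → d v ≤ 3 → 2 ≤ d z → d z ≤ 3 →
      g v + g z < -1 := by
    intro v hv z hz hvz h1 h2 h3 h4
    have hxv := hx v
    have hxz := hx z
    have hlv := l0 v
    have hlz := l0 z
    have hsv := s0 v
    have hsz := s0 z
    have e1 := eigp v hv z hz hvz
    have e2 := eigp z hz v hv hvz.symm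
    show ((d v : ℝ) - 1) * x v - d v / 2 - l v / 2 + (if d v = 1 then 1 / 2 else 0)
      - 2 / 5 * (if 2 ≤ d v then s v else 0) + (((d z : ℝ) - 1) * x z - d z / 2 - l z / 2 + (if d z = 1 then 1 / 2 else 0)
      - 2 / 5 * (if 2 ≤ d z then s z else 0)) < -1
    interval_cases hdv : d v <;> interval_cases hdz : d z <;> norm_num at e1 e2 ⊢ <;> linarith
  have mu1 := (memU _).2 hv1
  have mu2 := (memU _).2 hv2
  have mu3 := (memU _).2 hv3
  have mu4 := (memU _).2 hv4
  have p12 := pair v1 mu1 v2 mu2 a12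
    (d2 v1 mu1 y1 ((memU _).2 hy1) v2 mu2 n02 a01.symm a12)
    (theta_L1 G hfree u v1 v2 v3 hv1 hv2 hv3 a12 a23 n13.symm)
    (d2 v2 mu2 v1 mu1 v3 mu3 n13 a12.symm a23)
    (theta_L1 G hfree u v2 v3 v4 hv2 hv3 hv4 a23 a34 n24.symm)
  have p34 := pair v3 mu3 v4 mu4 a34
    (d2 v3 mu3 v2 mu2 v4 mu4 n24 a23.symm a34)
    (theta_L1 G hfree u v3 v2 v1 hv3 hv2 hv1 a23.symm a12.symm n13)
    (d2 v4 mu4 v3 mu3 y4 ((memU _).2 hy4) n35 a34.symm a45)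
    (theta_L1 G hfree u v4 v3 v2 hv4 hv3 hv2 a34.symm a23.symm n24)
  have sumg : ∑ v ∈ U, g v < -2 := by
    have hsub : ({v1, v2, v3, v4} : Finset V) ⊆ U := by
      intro z hz
      simp only [Finset.mem_insert, Finset.mem_singleton] at hz
      rcases hz with rfl | rfl | rfl | rfl <;> assumption
    have h := Finset.sum_le_sum_of_subset_of_nonneg (f := fun v => - g v) hsub
      (fun v hv _ => neg_nonneg.2 (g0 v hv))
    have hq : ∑ v ∈ ({v1, v2, v3, v4} : Finset V), (- g v) = -g v1 + (-g v2 + (-g v3 + -g v4)) := by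
      rw [Finset.sum_insert, Finset.sum_insert, Finset.sum_insert, Finset.sum_singleton]
      · simpa using a34.ne
      · simpa using ⟨a23.ne, n24⟩
      · simpa using ⟨a12.ne, n13, n14⟩
    rw [hq, Finset.sum_neg_distrib] at h
    linarith
  -- the W part
  have sums' : ∑ v ∈ U, 2 / 5 * s' v ≤ ∑ w ∈ W, ((d w : ℝ) - d w * x w + e w / 2) := by
    have h1 : ∑ v ∈ U, 2 / 5 * s' v
        = ∑ w ∈ W, ∑ v ∈ U, (if 2 ≤ d v ∧ G.Adj v w then 2 / 5 * x w else 0) := by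
      rw [Finset.sum_comm]
      refine Finset.sum_congr rfl fun v _ => ?_
      show 2 / 5 * (if 2 ≤ d v then s v else 0) = _
      by_cases h : 2 ≤ d v
      · simp only [h, if_true, true_and]
        show 2 / 5 * ∑ w ∈ W, _ = _
        rw [Finset.mul_sum]
        refine Finset.sum_congr rfl fun w _ => ?_
        split_ifs <;> simp
      · simp [h]
    rw [h1]
    refine Finset.sum_le_sum fun w hw => ?_
    have hxw := hx w
    have hx1w := hx1 w
    have hew := e0 w
    have hdw : (0 : ℝ) ≤ d w := Nat.cast_nonneg _
    by_cases hex : ∃ v ∈ U, 2 ≤ d v ∧ G.Adj v w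
    · obtain ⟨v, hv, hdv, hvw⟩ := hex
      have hd3 : d w ≤ 3 := theta_L2 G hfree u v w ((memU _).1 hv) ((memW _).1 hw).2
        ((memW _).1 hw).1 hvw hdv
      have hle : ∑ v ∈ U, (if 2 ≤ d v ∧ G.Adj v w then 2 / 5 * x w else 0) ≤ d w * (2 / 5 * x w) := by
        rw [dsum, Finset.sum_mul]
        refine Finset.sum_le_sum fun z _ => ?_
        by_cases h : G.Adj z w
        · rw [if_pos h.symm]
          split_ifs <;> linarith
        · rw [if_neg (fun h' => h h'.2)]
          split_ifs <;> linarith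
      refine hle.trans ?_
      have hW8 := eigW w hw
      interval_cases hdw' : d w <;> norm_num at hW8 ⊢ <;> linarith
    · rw [Finset.sum_eq_zero]
      · nlinarith
      · intro v hv
        exact if_neg (fun h => hex ⟨v, hv, h⟩)
  have hg : ∑ v ∈ U, g v = ∑ v ∈ U, f v - ∑ v ∈ U, 2 / 5 * s' v := by
    rw [← Finset.sum_sub_distrib]
  have hWs : ∑ w ∈ W, ((d w : ℝ) - d w * x w + e w / 2) =
      ∑ w ∈ W, (d w : ℝ) - ∑ w ∈ W, (d w : ℝ) * x w + (∑ w ∈ W, e w) / 2 := by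
    rw [Finset.sum_add_distrib, Finset.sum_sub_distrib, Finset.sum_div]
  linarith

/-- The comparison graph: `K₂ ∨ kK₁` together with `t` disjoint edges. -/
def cmpGraph (k t : ℕ) : SimpleGraph (Fin 2 ⊕ (Fin k ⊕ (Fin t × Bool))) :=
  SimpleGraph.fromRel (fun p q => match p, q with
    | Sum.inl _, Sum.inl _ => True
    | Sum.inl _, Sum.inr (Sum.inl _) => True
    | Sum.inr (Sum.inr a), Sum.inr (Sum.inr b) => a.1 = b.1
    | _, _ => False)

lemma cmp_ll (k t : ℕ) (i j : Fin 2) : (cmpGraph k t).Adj (Sum.inl i) (Sum.inl j) ↔ i ≠ j := by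
  simp [cmpGraph]

lemma cmp_lm (k t : ℕ) (i : Fin 2) (j : Fin k) :
    (cmpGraph k t).Adj (Sum.inl i) (Sum.inr (Sum.inl j)) := by
  simp [cmpGraph]

lemma cmp_ml (k t : ℕ) (i : Fin 2) (j : Fin k) :
    (cmpGraph k t).Adj (Sum.inr (Sum.inl j)) (Sum.inl i) := by
  simp [cmpGraph]

lemma cmp_mm (k t : ℕ) (i j : Fin k) :
    ¬ (cmpGraph k t).Adj (Sum.inr (Sum.inl i)) (Sum.inr (Sum.inl j)) := by
  simp [cmpGraph]

lemma cmp_lr (k t : ℕ) (i : Fin 2) (j : Fin t × Bool) :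
    ¬ (cmpGraph k t).Adj (Sum.inl i) (Sum.inr (Sum.inr j)) := by
  simp [cmpGraph]

lemma cmp_rl (k t : ℕ) (i : Fin 2) (j : Fin t × Bool) :
    ¬ (cmpGraph k t).Adj (Sum.inr (Sum.inr j)) (Sum.inl i) := by
  simp [cmpGraph]

lemma cmp_mr (k t : ℕ) (i : Fin k) (j : Fin t × Bool) :
    ¬ (cmpGraph k t).Adj (Sum.inr (Sum.inl i)) (Sum.inr (Sum.inr j)) := by
  simp [cmpGraph]

lemma cmp_rm (k t : ℕ) (i : Fin k) (j : Fin t × Bool) :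
    ¬ (cmpGraph k t).Adj (Sum.inr (Sum.inr j)) (Sum.inr (Sum.inl i)) := by
  simp [cmpGraph]

lemma cmp_rr (k t : ℕ) (i j : Fin t × Bool) :
    (cmpGraph k t).Adj (Sum.inr (Sum.inr i)) (Sum.inr (Sum.inr j)) ↔ j = (i.1, !i.2) := by
  obtain ⟨i, a⟩ := i
  obtain ⟨j, b⟩ := j
  cases a <;> cases b <;> simp [cmpGraph, Prod.ext_iff] <;> grind

lemma cmp_left (k t : ℕ) (p q r : Fin 2 ⊕ (Fin k ⊕ (Fin t × Bool)))
    (h1 : (cmpGraph k t).Adj p q) (h2 : (cmpGraph k t).Adj q r) (hpr : p ≠ r) :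
    ∃ i, p = Sum.inl i ∨ q = Sum.inl i := by
  rcases p with p | p | p
  · exact ⟨p, Or.inl rfl⟩
  · rcases q with q | q | q
    · exact ⟨q, Or.inr rfl⟩
    · exact absurd h1 (cmp_mm _ _ _ _)
    · exact absurd h1 (cmp_mr _ _ _ _)
  · rcases q with q | q | q
    · exact ⟨q, Or.inr rfl⟩
    · exact absurd h1 (cmp_rm _ _ _ _)
    · rcases r with r | r | r
      · exact absurd h2 (cmp_rl _ _ _ _)
      · exact absurd h2 (cmp_rm _ _ _ _)
      · rw [cmp_rr] at h1 h2
        subst h1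
        simp at h2
        subst h2
        exact absurd rfl hpr

lemma cmp_free (k t : ℕ) : ¬ Contains theta223 (cmpGraph k t) := by
  rintro ⟨f, hf⟩
  have t02 : theta223.Adj 0 2 := by simp [theta223]
  have t21 : theta223.Adj 2 1 := by simp [theta223]
  have t13 : theta223.Adj 1 3 := by simp [theta223]
  have t30 : theta223.Adj 3 0 := by simp [theta223]
  have t45 : theta223.Adj 4 5 := by simp [theta223]
  have t51 : theta223.Adj 5 1 := by simp [theta223]
  have inj := f.injective
  obtain ⟨i, hi⟩ := cmp_left k t _ _ _ (hf t02) (hf t21) (inj.ne (by decide))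
  obtain ⟨j, hj⟩ := cmp_left k t _ _ _ (hf t13) (hf t30) (inj.ne (by decide))
  obtain ⟨l, hl⟩ := cmp_left k t _ _ _ (hf t45) (hf t51) (inj.ne (by decide))
  have hij : i ≠ j := by
    rintro rfl
    rcases hi with hi | hi <;> rcases hj with hj | hj <;>
      exact absurd (inj (hi.trans hj.symm)) (by decide)
  have hil : i ≠ l := by
    rintro rfl
    rcases hi with hi | hi <;> rcases hl with hj | hj <;>
      exact absurd (inj (hi.trans hj.symm)) (by decide)
  have hjl : j ≠ l := by
    rintro rfl
    rcases hj with hi | hi <;> rcases hl with hj | hj <;>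
      exact absurd (inj (hi.trans hj.symm)) (by decide)
  omega

lemma cmp_iso (k t : ℕ) (v : Fin 2 ⊕ (Fin k ⊕ (Fin t × Bool))) : ∃ w, (cmpGraph k t).Adj v w := by
  rcases v with v | v | v
  · exact ⟨Sum.inl (v + 1), (cmp_ll ..).2 (by omega)⟩
  · exact ⟨Sum.inl 0, cmp_ml ..⟩
  · exact ⟨Sum.inr (Sum.inr (v.1, !v.2)), (cmp_rr ..).2 rfl⟩

open Classical in
/-- Handshake lemma in the form used here. -/
lemma handshake {V : Type*} [Fintype V] (G : SimpleGraph V) :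
    ∑ v, ∑ w, (if G.Adj v w then (1 : ℝ) else 0) = 2 * (G.edgeSet.ncard : ℝ) := by
  have h := G.sum_degrees_eq_twice_card_edges
  have h2 : G.edgeSet.ncard = G.edgeFinset.card := by
    rw [← SimpleGraph.coe_edgeFinset, Set.ncard_coe_finset]
  rw [h2]
  have h3 : ((∑ v, G.degree v : ℕ) : ℝ) = 2 * (G.edgeFinset.card : ℝ) := by
    rw [h]; push_cast; ring
  rw [← h3, Nat.cast_sum]
  refine Finset.sum_congr rfl fun v _ => ?_
  rw [Finset.sum_boole, ← SimpleGraph.card_neighborFinset_eq_degree]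
  congr 2
  ext w
  simp

open Classical in
lemma cmp_sum (k t : ℕ) (F : Fin 2 ⊕ (Fin k ⊕ (Fin t × Bool)) → ℝ)
    (v : Fin 2 ⊕ (Fin k ⊕ (Fin t × Bool))) :
    ∑ w, (if (cmpGraph k t).Adj v w then F w else 0) =
      match v with
      | Sum.inl i => F (Sum.inl (i + 1)) + ∑ j, F (Sum.inr (Sum.inl j))
      | Sum.inr (Sum.inl _) => F (Sum.inl 0) + F (Sum.inl 1)
      | Sum.inr (Sum.inr a) => F (Sum.inr (Sum.inr (a.1, !a.2))) := by
  rw [Fintype.sum_sum_type, Fintype.sum_sum_type]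
  rcases v with v | v | v
  · simp only [cmp_ll, cmp_lm, cmp_lr, if_true, if_false, Finset.sum_const_zero, add_zero,
      Fin.sum_univ_two]
    fin_cases v <;> simp
  · simp [cmp_ml, cmp_mm, cmp_mr]
  · simp [cmp_rl, cmp_rm, cmp_rr]

lemma cmp_edges (k t : ℕ) : (cmpGraph k t).edgeSet.ncard = 2 * k + 1 + t := by
  classical
  have h := handshake (cmpGraph k t)
  have h2 := fun v => cmp_sum k t (fun _ => 1) v
  simp only [h2] at h
  rw [Fintype.sum_sum_type, Fintype.sum_sum_type] at h
  simp at h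
  have : ((cmpGraph k t).edgeSet.ncard : ℝ) = ((2 * k + 1 + t : ℕ) : ℝ) := by
    push_cast
    linarith
  exact_mod_cast this

lemma adjMat_mulVec {V : Type*} [Fintype V] (G : SimpleGraph V) (x : V → ℝ) (v : V) :
    (adjMat G).mulVec x v = ∑ w, (open Classical in if G.Adj v w then x w else 0) := by
  simp [adjMat, Matrix.mulVec, dotProduct]

/-- The largest eigenvalue exists and dominates a given one. -/
lemma exists_spectral {n : ℕ} (H : SimpleGraph (Fin n)) (r : ℝ) (v : Fin n → ℝ) (hv : v ≠ 0)
    (h : (adjMat H).mulVec v = r • v) : ∃ μ, IsSpectralRadius H μ ∧ r ≤ μ := by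
  classical
  have hfin := Module.End.finite_hasEigenvalue (Matrix.toLin' (adjMat H))
  have key : ∀ (μ : ℝ) (v : Fin n → ℝ), v ≠ 0 → (adjMat H).mulVec v = μ • v →
      μ ∈ {μ | Module.End.HasEigenvalue (Matrix.toLin' (adjMat H)) μ} := by
    intro μ v hv h
    refine Module.End.hasEigenvalue_of_hasEigenvector (x := v) ⟨?_, hv⟩
    rw [Module.End.mem_eigenspace_iff, Matrix.toLin'_apply]
    exact h
  obtain ⟨μ, hμ, hmax⟩ := hfin.exists_maximal ⟨r, key r v hv h⟩
  have hle : ∀ b ∈ {μ | Module.End.HasEigenvalue (Matrix.toLin' (adjMat H)) μ}, b ≤ μ := by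
    intro b hb
    rcases le_total b μ with h | h
    · exact h
    · exact hmax hb h
  refine ⟨μ, ⟨?_, fun b w hw hb => hle b (key b w hw hb)⟩, hle r (key r v hv h)⟩
  obtain ⟨w, hw⟩ := Module.End.HasEigenvalue.exists_hasEigenvector hμ
  refine ⟨w, hw.2, ?_⟩
  have := Module.End.mem_eigenspace_iff.1 hw.1
  rwa [Matrix.toLin'_apply] at this

lemma lower_bound (m : ℕ) (hm57 : 57 ≤ m) (lam : ℝ)
    (hmax : ∀ (n : ℕ) (H : SimpleGraph (Fin n)) (μ : ℝ),
      H.edgeSet.ncard = m → ¬ Contains theta223 H → (∀ v, ∃ w, H.Adj v w) →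
      IsSpectralRadius H μ → μ ≤ lam) : 8 ≤ lam ∧ (m : ℝ) - 2 ≤ lam ^ 2 - lam := by
  classical
  obtain ⟨k, t, hkt, ht, hk⟩ : ∃ k t : ℕ, m = 2 * k + 1 + t ∧ t ≤ 1 ∧ 28 ≤ k :=
    ⟨(m - 1) / 2, (m - 1) % 2, by omega, by omega, by omega⟩
  let α := Fin 2 ⊕ (Fin k ⊕ (Fin t × Bool))
  let eq : Fin (Fintype.card α) ≃ α := (Fintype.equivFin α).symm
  let H : SimpleGraph (Fin (Fintype.card α)) := (cmpGraph k t).comap eq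
  let iso : H ≃g cmpGraph k t := SimpleGraph.Iso.comap eq (cmpGraph k t)
  -- the eigenvalue
  have hk' : (28 : ℝ) ≤ k := by exact_mod_cast hk
  set r : ℝ := (1 + Real.sqrt (1 + 8 * k)) / 2 with hr
  have hsq : Real.sqrt (1 + 8 * k) ^ 2 = 1 + 8 * k := Real.sq_sqrt (by linarith)
  have h15 : 15 ≤ Real.sqrt (1 + 8 * k) := by
    apply Real.le_sqrt_of_sq_le
    linarith
  have hr8 : 8 ≤ r := by rw [hr]; linarith
  have hrr : r ^ 2 - r = 2 * k := by rw [hr]; nlinarith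
  let y : α → ℝ := fun v => match v with
    | Sum.inl _ => r
    | Sum.inr (Sum.inl _) => 2
    | Sum.inr (Sum.inr _) => 0
  have hy : ∀ v, ∑ w, (if (cmpGraph k t).Adj v w then y w else 0) = r * y v := by
    intro v
    rw [cmp_sum]
    rcases v with v | v | v
    · simp [y]; nlinarith
    · simp [y]; ring
    · simp [y]
  have hedge : H.edgeSet.ncard = m := by
    rw [hkt, ← cmp_edges k t]
    exact Set.ncard_congr' iso.mapEdgeSet
  have hfreeH : ¬ Contains theta223 H := by
    rintro ⟨f, hf⟩
    exact cmp_free k t ⟨f.trans eq.toEmbedding, fun a b hab => hf hab⟩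
  have hisoH : ∀ v, ∃ w, H.Adj v w := by
    intro v
    obtain ⟨w, hw⟩ := cmp_iso k t (eq v)
    exact ⟨eq.symm w, by simpa [H] using hw⟩
  have hne : (fun i => y (eq i)) ≠ 0 := by
    intro h
    have := congrFun h (eq.symm (Sum.inl 0))
    simp [y] at this
    linarith
  obtain ⟨μ, hμ, hle⟩ := exists_spectral H r (fun i => y (eq i)) hne (by
    ext i
    rw [adjMat_mulVec]
    have := hy (eq i)
    rw [← Equiv.sum_comp eq] at this
    simp only [Pi.smul_apply, smul_eq_mul]
    exact this)
  have hrl : r ≤ lam := hle.trans (hmax _ H μ hedge hfreeH hisoH hμ)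
  refine ⟨hr8.trans hrl, ?_⟩
  have hm' : (m : ℝ) = 2 * k + 1 + t := by exact_mod_cast hkt
  have ht' : (t : ℝ) ≤ 1 := by exact_mod_cast ht
  nlinarith

theorem stmt7 {V : Type*} [Fintype V] (G : SimpleGraph V) (m : ℕ)
    (hm : G.edgeSet.ncard = m) (hm57 : 57 ≤ m)
    (hfree : ¬ Contains theta223 G)
    (hiso : ∀ v : V, ∃ w, G.Adj v w)
    (lam : ℝ) (hlam : IsSpectralRadius G lam)
    (hmax : ∀ (n : ℕ) (H : SimpleGraph (Fin n)) (μ : ℝ),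
      H.edgeSet.ncard = m → ¬ Contains theta223 H → (∀ v, ∃ w, H.Adj v w) →
      IsSpectralRadius H μ → μ ≤ lam)
    (x : V → ℝ) (hx : ∀ v, 0 < x v)
    (heig : (adjMat G).mulVec x = lam • x)
    (ustar : V) (hustar : ∀ v, x v ≤ x ustar) :
    ¬ ∃ (v : G.neighborSet ustar)
        (p : (G.induce (G.neighborSet ustar)).Walk v v),
        p.IsCycle ∧ 4 ≤ p.length := by
  classical
  rintro ⟨v, p, hp, hlen⟩
  obtain ⟨h8, hlm⟩ := lower_bound m hm57 lam hmax
  have hu0 : 0 < x ustar := hx ustar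
  have inj := hp.getVert_injOn'
  have ne : ∀ i j, i ≤ p.length - 1 → j ≤ p.length - 1 → i ≠ j →
      (p.getVert i : V) ≠ p.getVert j := by
    intro i j hi hj hij h
    exact hij (inj hi hj (Subtype.ext h))
  have adj : ∀ i, i < p.length → G.Adj (p.getVert i : V) (p.getVert (i + 1)) := by
    intro i hi
    exact p.adj_getVert_succ hi
  have hends : p.getVert p.length = p.getVert 0 := by
    rw [p.getVert_length, p.getVert_zero]
  have hlast := adj (p.length - 1) (by omega)
  rw [show p.length - 1 + 1 = p.length by omega, hends] at hlast
  have n35 : (p.getVert 2 : V) ≠ p.getVert 4 := by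
    rcases eq_or_lt_of_le hlen with h | h
    · have h40 : p.getVert 4 = p.getVert 0 := by rw [← hends, ← h]
      rw [h40]
      exact ne _ _ (by omega) (by omega) (by omega)
    · exact ne _ _ (by omega) (by omega) (by omega)
  refine core G hfree m lam h8 hlm (fun v => x v / x ustar) (fun v => div_pos (hx v) hu0)
    (fun v => (div_le_one hu0).2 (hustar v)) ?_ ?_ ustar (div_self hu0.ne')
    (p.getVert (p.length - 1)) (p.getVert 0) (p.getVert 1) (p.getVert 2) (p.getVert 3) (p.getVert 4)
    (p.getVert _).2 (p.getVert _).2 (p.getVert _).2 (p.getVert _).2 (p.getVert _).2 (p.getVert _).2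
    hlast (adj 0 (by omega)) (adj 1 (by omega)) (adj 2 (by omega)) (adj 3 (by omega))
    (ne _ _ (by omega) (by omega) (by omega)) (ne _ _ (by omega) (by omega) (by omega))
    (ne _ _ (by omega) (by omega) (by omega)) (ne _ _ (by omega) (by omega) (by omega)) n35
  · intro v
    have h := congrFun heig v
    rw [adjMat_mulVec, Pi.smul_apply, smul_eq_mul] at h
    rw [← mul_div_assoc, ← h, Finset.sum_div]
    refine Finset.sum_congr rfl fun w _ => ?_
    split_ifs <;> simp
  · rw [handshake, hm]
end

section
/- Let m ≥ 57 and let G* attain the maximum spectral radius among all θ_{2,2,3}-free graphs with m edges and no isolated vertices. Let x be a positive eigenvector of the adjacency matrix of G* corresponding to λ(G*), let u* be a vertex maximizing the entries of x, and set W = V(G*) \ N[u*]. Then W is an independent set of G*, i.e., e(W) = 0. -/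
open SimpleGraph

/-- Vertex type of the comparison graph: two hubs, `k` common neighbours, `r` pendants. -/
abbrev CT (k r : ℕ) := Fin 2 ⊕ (Fin k ⊕ Fin r)

/-- Adjacency in the comparison graph. -/
def cadj {k r : ℕ} : CT k r → CT k r → Prop
  | .inl i, .inl j => i ≠ j
  | .inl _, .inr (.inl _) => True
  | .inr (.inl _), .inl _ => True
  | .inl i, .inr (.inr _) => i = 0
  | .inr (.inr _), .inl i => i = 0
  | .inr _, .inr _ => False

/-- The comparison graph. -/
def cgraph (k r : ℕ) : SimpleGraph (CT k r) where
  Adj := cadj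
  symm := ⟨by
    rintro (i | i | i) (j | j | j) h <;> simp_all [cadj, eq_comm]⟩
  loopless := ⟨by rintro (i | i | i) h <;> simp_all [cadj]⟩

lemma cgraph_cover {k r : ℕ} {s t : CT k r} (h : (cgraph k r).Adj s t) :
    s = .inl 0 ∨ s = .inl 1 ∨ t = .inl 0 ∨ t = .inl 1 := by
  have key : ∀ i : Fin 2, i = 0 ∨ i = 1 := by decide
  rcases s with i | i | i <;> rcases t with j | j | j <;>
    simp [cgraph, cadj] at h ⊢
  · rcases key i with h1 | h1 <;> simp [h1]
  · exact key i
  · exact Or.inl h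
  · exact key j
  · exact Or.inl h

lemma cgraph_free (k r : ℕ) : ¬ Contains theta223 (cgraph k r) := by
  rintro ⟨f, hf⟩
  have h1 := cgraph_cover (hf (a := 0) (b := 2) (by simp [theta223]))
  have h2 := cgraph_cover (hf (a := 2) (b := 1) (by simp [theta223]))
  have h3 := cgraph_cover (hf (a := 0) (b := 4) (by simp [theta223]))
  have h4 := cgraph_cover (hf (a := 4) (b := 5) (by simp [theta223]))
  have h5 := cgraph_cover (hf (a := 5) (b := 1) (by simp [theta223]))
  have e : ∀ i j : Fin 6, i ≠ j → f i ≠ f j := fun i j h h' => h (f.injective h')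
  have e01 := e 0 1 (by decide)
  have e02 := e 0 2 (by decide)
  have e04 := e 0 4 (by decide)
  have e05 := e 0 5 (by decide)
  have e12 := e 1 2 (by decide)
  have e14 := e 1 4 (by decide)
  have e15 := e 1 5 (by decide)
  have e24 := e 2 4 (by decide)
  have e25 := e 2 5 (by decide)
  have e45 := e 4 5 (by decide)
  clear e hf
  generalize f 0 = a0 at *
  generalize f 1 = a1 at *
  generalize f 2 = a2 at *
  generalize f 4 = a4 at *
  generalize f 5 = a5 at *
  grind

lemma adjMat_edges {V : Type*} [Fintype V] (G : SimpleGraph V) :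
    ∑ v, ∑ w, adjMat G v w = 2 * (G.edgeSet.ncard : ℝ) := by
  classical
  have h := G.sum_degrees_eq_twice_card_edges
  rw [← SimpleGraph.coe_edgeFinset, Set.ncard_coe_finset]
  have h' : ((∑ v, G.degree v : ℕ) : ℝ) = 2 * (G.edgeFinset.card : ℝ) := by
    rw [h]; push_cast; ring
  rw [← h']
  push_cast
  refine Finset.sum_congr rfl fun v _ => ?_
  rw [← SimpleGraph.card_neighborFinset_eq_degree, SimpleGraph.neighborFinset_eq_filter]
  simp [adjMat]

lemma cgraph_sum (k r : ℕ) (z : CT k r → CT k r → ℝ) :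
    ∑ s, ∑ t, adjMat (cgraph k r) s t * z s t =
      z (.inl 0) (.inl 1) + z (.inl 1) (.inl 0)
      + ∑ i : Fin k, (z (.inl 0) (.inr (.inl i)) + z (.inl 1) (.inr (.inl i))
        + z (.inr (.inl i)) (.inl 0) + z (.inr (.inl i)) (.inl 1))
      + ∑ i : Fin r, (z (.inl 0) (.inr (.inr i)) + z (.inr (.inr i)) (.inl 0)) := by
  simp [adjMat, cgraph, cadj, Fintype.sum_sum_type, Fin.sum_univ_two, Finset.sum_add_distrib]
  ring

/-- Spectral radius exists and dominates Rayleigh quotients. -/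
lemma exists_radius {V : Type*} [Fintype V] [Nonempty V] (G : SimpleGraph V) :
    ∃ μ, IsSpectralRadius G μ ∧
      ∀ y : V → ℝ, ∑ s, ∑ t, adjMat G s t * (y s * y t) ≤ μ * ∑ s, y s ^ 2 := by
  classical
  have hA : (adjMat G).IsHermitian := by
    ext i j; simp [adjMat, G.adj_comm]
  obtain ⟨i0, -, hi0⟩ := Finset.exists_max_image Finset.univ hA.eigenvalues Finset.univ_nonempty
  set μ := hA.eigenvalues i0
  have hR : ∀ y : V → ℝ, ∑ s, ∑ t, adjMat G s t * (y s * y t) ≤ μ * ∑ s, y s ^ 2 := by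
    intro y
    have hpsd : (μ • (1 : Matrix V V ℝ) - adjMat G).PosSemidef := by
      have hB : (μ • (1 : Matrix V V ℝ) - adjMat G).IsHermitian := by
        refine Matrix.IsHermitian.sub ?_ hA
        ext i j; simp [Matrix.one_apply, eq_comm]
      rw [hB.posSemidef_iff_eigenvalues_nonneg]
      intro i
      have h1 := hB.eigenvalues_mem_spectrum_real i
      generalize hB.eigenvalues i = β at h1
      rw [← Algebra.algebraMap_eq_smul_one, ← spectrum.singleton_sub_eq,
        hA.spectrum_real_eq_range_eigenvalues] at h1
      obtain ⟨a, ha, b, ⟨j, rfl⟩, h2⟩ := h1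
      have h3 := hi0 j (Finset.mem_univ _)
      simp only [Set.mem_singleton_iff] at ha
      subst ha
      have h4 : μ - hA.eigenvalues j = β := h2
      simp only [Pi.zero_apply]
      linarith
    have := hpsd.dotProduct_mulVec_nonneg y
    have e1 : ∑ s, ∑ t, adjMat G s t * (y s * y t) = y ⬝ᵥ (adjMat G).mulVec y := by
      simp only [dotProduct, Matrix.mulVec, Finset.mul_sum]
      exact Finset.sum_congr rfl fun s _ => Finset.sum_congr rfl fun t _ => by ring
    have e2 : ∑ s, y s ^ 2 = y ⬝ᵥ y := by
      simp only [dotProduct, sq]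
    rw [e1, e2]
    simp [Matrix.sub_mulVec, dotProduct_sub, Matrix.smul_mulVec] at this
    linarith
  refine ⟨μ, ⟨⟨_, ?_, hA.mulVec_eigenvectorBasis i0⟩, ?_⟩, hR⟩
  · intro h0
    have := hA.eigenvectorBasis.orthonormal.ne_zero i0
    apply this
    ext j
    exact congrFun h0 j
  · intro ν v hv h
    have h1 := hR v
    have h2 : ∑ s, ∑ t, adjMat G s t * (v s * v t) = ν * ∑ s, v s ^ 2 := by
      rw [Finset.mul_sum]
      refine Finset.sum_congr rfl fun s _ => ?_
      have := congrFun h s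
      simp only [Matrix.mulVec, dotProduct, Pi.smul_apply, smul_eq_mul] at this
      calc _ = v s * ∑ t, adjMat G s t * v t := by
            rw [Finset.mul_sum]; exact Finset.sum_congr rfl fun t _ => by ring
        _ = _ := by rw [this]; ring
    have h3 : 0 < ∑ s, v s ^ 2 := by
      obtain ⟨s, hs⟩ := Function.ne_iff.mp hv
      exact Finset.sum_pos' (fun _ _ => sq_nonneg _) ⟨s, Finset.mem_univ _, by
        have : v s ≠ 0 := hs
        positivity⟩
    rw [h2] at h1
    exact le_of_mul_le_mul_right h1 h3

lemma lam_lower (m : ℕ) (hm57 : 57 ≤ m) (lam : ℝ)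
    (hmax : ∀ (n : ℕ) (H : SimpleGraph (Fin n)) (μ : ℝ),
      H.edgeSet.ncard = m → ¬ Contains theta223 H → (∀ v, ∃ w, H.Adj v w) →
      IsSpectralRadius H μ → μ ≤ lam) :
    8 ≤ lam ∧ (m : ℝ) - 2 < lam ^ 2 - lam := by
  classical
  obtain ⟨k, r, hr, hk, hm⟩ : ∃ k r : ℕ, r ≤ 1 ∧ 28 ≤ k ∧ m = 2 * k + 1 + r :=
    ⟨(m - 1) / 2, (m - 1) % 2, by omega, by omega, by omega⟩
  set n := Fintype.card (CT k r) with hn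
  let e : CT k r ≃ Fin n := Fintype.equivFin _
  let H : SimpleGraph (Fin n) := (cgraph k r).comap e.symm
  have hadj : ∀ s t, adjMat H (e s) (e t) = adjMat (cgraph k r) s t := by
    intro s t; simp [adjMat, H]
  have hsum : ∀ z : Fin n → Fin n → ℝ, ∑ s, ∑ t, adjMat H s t * z s t
      = ∑ s, ∑ t, adjMat (cgraph k r) s t * z (e s) (e t) := by
    intro z
    rw [← Equiv.sum_comp e]
    refine Finset.sum_congr rfl fun s _ => ?_
    rw [← Equiv.sum_comp e]
    simp only [hadj]
  have hedge : H.edgeSet.ncard = m := by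
    have h1 := adjMat_edges H
    have h2 := hsum (fun _ _ => 1)
    simp only [mul_one] at h2
    have h3 := cgraph_sum k r (fun _ _ => 1)
    simp only [mul_one] at h3
    rw [h1, h3] at h2
    simp at h2
    have : (H.edgeSet.ncard : ℝ) = (m : ℝ) := by
      rw [hm]; push_cast; linarith
    exact_mod_cast this
  have hfree : ¬ Contains theta223 H := by
    rintro ⟨f, hf⟩
    exact cgraph_free k r ⟨f.trans e.symm.toEmbedding, fun a b h => hf h⟩
  have hiso : ∀ v, ∃ w, H.Adj v w := by
    intro v
    have : ∀ s : CT k r, ∃ t, (cgraph k r).Adj s t := by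
      rintro (i | i | i)
      · exact ⟨.inr (.inl ⟨0, by omega⟩), trivial⟩
      · exact ⟨.inl 0, trivial⟩
      · exact ⟨.inl 0, rfl⟩
    obtain ⟨t, ht⟩ := this (e.symm v)
    exact ⟨e t, by simpa [H] using ht⟩
  have : Nonempty (Fin n) := ⟨e (.inl 0)⟩
  obtain ⟨μ, hμ, hR⟩ := exists_radius H
  have hle := hmax n H μ hedge hfree hiso hμ
  set ρ : ℝ := (1 + Real.sqrt (1 + 8 * k)) / 2 with hρ
  have hkR : (28 : ℝ) ≤ k := by exact_mod_cast hk
  have hsq : Real.sqrt (1 + 8 * k) ^ 2 = 1 + 8 * k := Real.sq_sqrt (by positivity)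
  have hs15 : 15 ≤ Real.sqrt (1 + 8 * k) := Real.le_sqrt_of_sq_le (by linarith)
  have hρ8 : 8 ≤ ρ := by linarith
  have hρ2 : ρ ^ 2 - ρ = 2 * k := by rw [hρ]; linarith
  let y0 : CT k r → ℝ := fun s => match s with
    | .inl _ => ρ
    | .inr (.inl _) => 2
    | .inr (.inr _) => 1
  have hy := hR (fun s => y0 (e.symm s))
  rw [hsum (fun s t => y0 (e.symm s) * y0 (e.symm t))] at hy
  simp only [Equiv.symm_apply_apply] at hy
  rw [cgraph_sum k r (fun s t => y0 s * y0 t),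
    Equiv.sum_comp e.symm (fun s => y0 s ^ 2)] at hy
  simp [y0, Fintype.sum_sum_type] at hy
  have hN : 0 < ρ ^ 2 + ρ ^ 2 + (k * 2 ^ 2 + (r : ℝ)) := by positivity
  have hkey : ρ * r ≤ (μ - ρ) * (ρ ^ 2 + ρ ^ 2 + (k * 2 ^ 2 + (r : ℝ))) := by
    have hk' : (k : ℝ) = (ρ ^ 2 - ρ) / 2 := by linarith
    rw [hk'] at hy ⊢
    nlinarith
  have hmR : (m : ℝ) = 2 * k + 1 + r := by rw [hm]; push_cast; ring
  have hr' : r = 0 ∨ r = 1 := by omega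
  rcases hr' with rfl | rfl
  · have : 0 ≤ μ - ρ := by
      by_contra h
      push Not at h
      have := mul_neg_of_neg_of_pos h hN
      push_cast at *
      linarith
    push_cast at *
    constructor
    · linarith
    · nlinarith
  · have : 0 < μ - ρ := by
      by_contra h
      push Not at h
      have := mul_nonpos_of_nonpos_of_nonneg h hN.le
      push_cast at *
      linarith
    push_cast at *
    constructor
    · linarith
    · nlinarith

lemma theta_of {V : Type*} (G : SimpleGraph V) (a b c₁ c₂ d₁ d₂ : V)
    (h1 : G.Adj a c₁) (h2 : G.Adj c₁ b) (h3 : G.Adj a c₂) (h4 : G.Adj c₂ b)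
    (h5 : G.Adj a d₁) (h6 : G.Adj d₁ d₂) (h7 : G.Adj d₂ b)
    (n1 : a ≠ b) (n2 : c₁ ≠ c₂) (n3 : c₁ ≠ d₁) (n4 : c₁ ≠ d₂) (n5 : c₂ ≠ d₁) (n6 : c₂ ≠ d₂)
    (n7 : b ≠ d₁) (n8 : a ≠ d₂) : Contains theta223 G := by
  refine ⟨⟨![a, b, c₁, c₂, d₁, d₂], ?_⟩, ?_⟩
  · have := h1.ne
    have := h2.ne
    have := h3.ne
    have := h4.ne
    have := h5.ne
    have := h6.ne
    have := h7.ne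
    intro i j hij
    fin_cases i <;> fin_cases j <;> first | rfl | (exfalso; simp at hij; simp_all)
  · intro i j hij
    simp only [theta223, SimpleGraph.fromRel_adj] at hij
    obtain ⟨-, h | h⟩ := hij <;>
    rcases h with ⟨rfl, rfl⟩ | ⟨rfl, rfl⟩ | ⟨rfl, rfl⟩ | ⟨rfl, rfl⟩ | ⟨rfl, rfl⟩ |
      ⟨rfl, rfl⟩ | ⟨rfl, rfl⟩ <;> 
      first | exact h1 | exact h1.symm | exact h2 | exact h2.symm | exact h3 | exact h3.symm | exact h4 | exact h4.symm | exact h5 | exact h5.symm | exact h6 | exact h6.symm | exact h7 | exact h7.symm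

open Classical in
lemma card_le_three {V : Type*} [Fintype V] (G : SimpleGraph V) (hfree : ¬ Contains theta223 G)
    (u b d₁ d₂ : V) (hb : b ≠ u) (h1 : G.Adj u d₁) (h2 : G.Adj u d₂) (h3 : G.Adj b d₂)
    (h4 : G.Adj d₂ d₁) (h5 : d₁ ≠ b) :
    (Finset.univ.filter fun c => G.Adj u c ∧ G.Adj b c).card ≤ 3 := by
  by_contra hc
  push Not at hc
  set S := Finset.univ.filter fun c => G.Adj u c ∧ G.Adj b c
  have h : 1 < ((S.erase d₁).erase d₂).card := by
    have e1 := Finset.pred_card_le_card_erase (s := S) (a := d₁)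
    have e2 := Finset.pred_card_le_card_erase (s := S.erase d₁) (a := d₂)
    omega
  obtain ⟨c₁, hc1, c₂, hc2, hne⟩ := Finset.one_lt_card.mp h
  simp only [Finset.mem_erase, S, Finset.mem_filter, Finset.mem_univ, true_and] at hc1 hc2
  exact hfree (theta_of G u b c₁ c₂ d₁ d₂ hc1.2.2.1 hc1.2.2.2.symm hc2.2.2.1 hc2.2.2.2.symm h1
    h4.symm h3.symm hb.symm hne hc1.2.1 hc1.1 hc2.2.1 hc2.1 h5.symm h2.ne)

/-- Local bound at a vertex of `N`. -/
lemma local_N (c : ℕ) (y t : ℝ) (hy0 : 0 ≤ y) (hy1 : y ≤ 1) (ht : 0 ≤ t)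
    (h : 8 * y ≤ 1 + c + t) :
    ((c : ℝ) - 1) * y - c / 2 ≤
      (if 4 ≤ c then ((c : ℝ) / 2 - 1) else if 1 ≤ c then -(1 / 2) else 0) +
      (if 1 ≤ c then 1 / 4 else 0) * t := by
  by_cases h4 : 4 ≤ c
  · have : (4 : ℝ) ≤ c := by exact_mod_cast h4
    have h1 : 1 ≤ c := by omega
    simp only [h4, h1, if_true]
    nlinarith
  · have : c = 0 ∨ c = 1 ∨ c = 2 ∨ c = 3 := by omega
    rcases this with rfl | rfl | rfl | rfl <;> norm_num at * <;> linarith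

/-- Local bound at a vertex of `W`. -/
lemma local_W (cN cW n1 : ℕ) (lam y : ℝ) (hy0 : 0 ≤ y) (hy1 : y ≤ 1) (hlam : 8 ≤ lam)
    (hle : n1 ≤ cN) (h3 : 1 ≤ n1 → cN ≤ 3) (h : lam * y ≤ cN + cW) :
    (cN : ℝ) * (y - 1) + n1 * y / 4 ≤ 3 / 16 * cW ∧
    (cW ≤ 3 → (cN : ℝ) * (y - 1) + n1 * y / 4 ≤ 0) := by
  have h8 : 8 * y ≤ cN + cW := by nlinarith
  have hcN : (0 : ℝ) ≤ cN := by positivity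
  have hcW : (0 : ℝ) ≤ cW := by positivity
  by_cases h1 : 1 ≤ n1
  · have h3' : (cN : ℝ) ≤ 3 := by exact_mod_cast h3 h1
    have hle' : (n1 : ℝ) ≤ cN := by exact_mod_cast hle
    have hA : (cN : ℝ) * (y - 1) + n1 * y / 4 ≤ cN * (5 / 4 * y - 1) := by nlinarith
    have hB : cW ≤ 3 → (cN : ℝ) * (y - 1) + n1 * y / 4 ≤ 0 := by
      intro hw
      have hw' : (cW : ℝ) ≤ 3 := by exact_mod_cast hw
      have : 5 / 4 * y - 1 ≤ 0 := by linarith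
      nlinarith
    refine ⟨?_, hB⟩
    by_cases hw : cW ≤ 3
    · exact (hB hw).trans (by positivity)
    · have hw' : (4 : ℝ) ≤ cW := by exact_mod_cast (by omega : 4 ≤ cW)
      have : cN * (5 / 4 * y - 1) ≤ 3 / 4 := by nlinarith
      linarith
  · have : n1 = 0 := by omega
    subst this
    have : (cN : ℝ) * (y - 1) ≤ 0 := mul_nonpos_of_nonneg_of_nonpos hcN (by linarith)
    push_cast
    constructor
    · nlinarith
    · intro _; linarith

open Classical in
lemma core_s8 {V : Type*} [Fintype V] (G : SimpleGraph V) (hfree : ¬ Contains theta223 G)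
    (lam : ℝ) (hlam : 8 ≤ lam)
    (hlow : (G.edgeSet.ncard : ℝ) - 2 < lam ^ 2 - lam)
    (y : V → ℝ) (hy0 : ∀ v, 0 < y v) (hy1 : ∀ v, y v ≤ 1)
    (heig : ∀ v, ∑ w, adjMat G v w * y w = lam * y v)
    (u : V) (hyu : y u = 1) (w₁ w₂ : V) (h1 : w₁ ≠ u) (h1' : ¬ G.Adj u w₁)
    (h2 : w₂ ≠ u) (h2' : ¬ G.Adj u w₂) (hw : G.Adj w₁ w₂) : False := by
  set a := adjMat G with ha
  have asymm : ∀ v w, a v w = a w v := by intro v w; simp [ha, adjMat, G.adj_comm]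
  have a0 : ∀ v w, 0 ≤ a v w := by intro v w; simp only [ha, adjMat, Matrix.of_apply]; split_ifs <;> norm_num
  have a1 : ∀ v w, G.Adj v w → a v w = 1 := by intro v w h; simp [ha, adjMat, h]
  have an : ∀ v w, ¬ G.Adj v w → a v w = 0 := by intro v w h; simp [ha, adjMat, h]
  set N : Finset V := Finset.univ.filter fun v => G.Adj u v with hN
  set W : Finset V := Finset.univ.filter fun v => v ≠ u ∧ ¬ G.Adj u v with hW
  have mN : ∀ v, v ∈ N ↔ G.Adj u v := by intro v; simp [hN]
  have mW : ∀ v, v ∈ W ↔ v ≠ u ∧ ¬ G.Adj u v := by intro v; simp [hW]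
  have split : ∀ f : V → ℝ, ∑ v, f v = f u + ∑ v ∈ N, f v + ∑ v ∈ W, f v := by
    intro f
    have hd : Disjoint N W := by
      rw [Finset.disjoint_left]; intro v hv hv'
      rw [mN] at hv; rw [mW] at hv'; exact hv'.2 hv
    have hu : u ∉ N ∪ W := by simp [mN, mW]
    have : (Finset.univ : Finset V) = insert u (N ∪ W) := by
      ext v
      simp only [Finset.mem_univ, Finset.mem_insert, Finset.mem_union, mN, mW, true_iff]
      tauto
    rw [this, Finset.sum_insert hu, Finset.sum_union hd]; ring
  -- degrees
  let cN : V → ℕ := fun v => (Finset.univ.filter fun c => G.Adj u c ∧ G.Adj v c).card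
  let cW : V → ℕ := fun v => (W.filter fun c => G.Adj v c).card
  have dN : ∀ v, ∑ w ∈ N, a v w = cN v := by
    intro v
    simp [ha, adjMat, cN, hN, Finset.filter_filter]
  have dW : ∀ v, ∑ w ∈ W, a v w = cW v := by
    intro v
    simp [ha, adjMat, cW]
  have auu : a u u = 0 := an _ _ (G.loopless.irrefl u)
  have auN : ∀ v ∈ N, a u v = 1 := fun v hv => a1 _ _ ((mN v).1 hv)
  have auW : ∀ v ∈ W, a u v = 0 := fun v hv => an _ _ ((mW v).1 hv).2
  -- (1)
  have e1 : lam = ∑ v ∈ N, y v := by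
    have := heig u
    rw [split, auu, hyu, Finset.sum_congr rfl (fun v hv => by rw [auN v hv, one_mul]),
      Finset.sum_congr (s₁ := W) rfl (fun v hv => by rw [auW v hv, zero_mul])] at this
    simp at this
    linarith
  have eN : ∀ v ∈ N, lam * y v = 1 + ∑ w ∈ N, a v w * y w + ∑ w ∈ W, a v w * y w := by
    intro v hv
    rw [← heig v, split, asymm v u, auN v hv, hyu, one_mul]
  have eW : ∀ v ∈ W, lam * y v = ∑ w ∈ N, a v w * y w + ∑ w ∈ W, a v w * y w := by
    intro v hv
    rw [← heig v, split, asymm v u, auW v hv]; ring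
  have swap : ∀ (S T : Finset V) (f : V → V → ℝ), ∑ v ∈ S, ∑ w ∈ T, a v w * f v w
      = ∑ w ∈ T, ∑ v ∈ S, a w v * f v w := by
    intro S T f
    rw [Finset.sum_comm]
    exact Finset.sum_congr rfl fun w _ => Finset.sum_congr rfl fun v _ => by rw [asymm]
  -- (2)
  have e2 : lam ^ 2 = (N.card : ℝ) + ∑ v ∈ N, cN v * y v + ∑ w ∈ W, cN w * y w := by
    have : lam ^ 2 = ∑ v ∈ N, lam * y v := by rw [← Finset.mul_sum, ← e1]; ring
    rw [this, Finset.sum_congr rfl eN, Finset.sum_add_distrib, Finset.sum_add_distrib,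
      swap N N (fun v w => y w), swap N W (fun v w => y w)]
    simp only [← Finset.sum_mul, dN]
    simp
  -- (3)
  have e3 : 2 * (G.edgeSet.ncard : ℝ) = 2 * (N.card : ℝ) + ∑ v ∈ N, (cN v : ℝ)
      + 2 * ∑ w ∈ W, (cN w : ℝ) + ∑ w ∈ W, (cW w : ℝ) := by
    rw [← adjMat_edges G, ← ha, split]
    have r1 : ∑ w, a u w = N.card := by
      rw [split, auu, Finset.sum_congr rfl auN, Finset.sum_congr rfl auW]; simp
    have r2 : ∀ v ∈ N, ∑ w, a v w = 1 + cN v + cW v := by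
      intro v hv; rw [split, asymm v u, auN v hv, dN, dW]
    have r3 : ∀ v ∈ W, ∑ w, a v w = cN v + cW v := by
      intro v hv; rw [split, asymm v u, auW v hv, dN, dW]; ring
    have r4 : ∑ v ∈ N, (cW v : ℝ) = ∑ w ∈ W, (cN w : ℝ) := by
      have := swap N W (fun _ _ => 1)
      simpa only [mul_one, dN, dW] using this
    rw [r1, Finset.sum_congr rfl r2, Finset.sum_congr rfl r3]
    simp only [Finset.sum_add_distrib]
    rw [r4]
    simp
    ring
  -- main inequality
  have hS : -2 < ∑ v ∈ N, (((cN v : ℝ) - 1) * y v - cN v / 2)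
      + ∑ w ∈ W, (cN w * (y w - 1)) - (∑ w ∈ W, (cW w : ℝ)) / 2 := by
    have q1 : ∑ v ∈ N, (((cN v : ℝ) - 1) * y v - cN v / 2)
      = ∑ v ∈ N, cN v * y v - ∑ v ∈ N, y v - (∑ v ∈ N, (cN v : ℝ)) / 2 := by
      rw [Finset.sum_div, ← Finset.sum_sub_distrib, ← Finset.sum_sub_distrib]
      exact Finset.sum_congr rfl fun v _ => by ring
    have q2 : ∑ w ∈ W, (cN w * (y w - 1)) = ∑ w ∈ W, cN w * y w - ∑ w ∈ W, (cN w : ℝ) := by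
      rw [← Finset.sum_sub_distrib]
      exact Finset.sum_congr rfl fun v _ => by ring
    rw [q1, q2, ← e1]
    linarith
  set D : ℝ := ∑ w ∈ W, (cW w : ℝ) with hD
  have hw1 : w₁ ∈ W := (mW _).2 ⟨h1, h1'⟩
  have hw2 : w₂ ∈ W := (mW _).2 ⟨h2, h2'⟩
  have hD2 : 2 ≤ D := by
    have p1 : 1 ≤ cW w₁ := Finset.card_pos.mpr ⟨w₂, by simp [hw2, hw]⟩
    have p2 : 1 ≤ cW w₂ := Finset.card_pos.mpr ⟨w₁, by simp [hw1, hw.symm]⟩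
    have p1' : (1 : ℝ) ≤ cW w₁ := by exact_mod_cast p1
    have p2' : (1 : ℝ) ≤ cW w₂ := by exact_mod_cast p2
    have : ∑ w ∈ {w₁, w₂}, (cW w : ℝ) ≤ D :=
      Finset.sum_le_sum_of_subset_of_nonneg (by intro z; simp; rintro (rfl | rfl) <;> assumption)
        (fun _ _ _ => by positivity)
    rw [Finset.sum_pair hw.ne] at this
    linarith
  have cNpos : ∀ v z, G.Adj u z → G.Adj v z → 1 ≤ cN v := fun v z h h' =>
    Finset.card_pos.mpr ⟨z, by simp [h, h']⟩
  have cNex : ∀ v, 1 ≤ cN v → ∃ z, G.Adj u z ∧ G.Adj v z := by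
    intro v h
    obtain ⟨z, hz⟩ := Finset.card_pos.mp h
    exact ⟨z, by simpa using hz⟩
  by_cases hex : ∃ v ∈ N, 1 ≤ cN v
  swap
  · push Not at hex
    have q1 : ∑ v ∈ N, (((cN v : ℝ) - 1) * y v - cN v / 2) = - lam := by
      rw [e1, ← Finset.sum_neg_distrib]
      refine Finset.sum_congr rfl fun v hv => ?_
      have : cN v = 0 := by have := hex v hv; omega
      rw [this]; push_cast; ring
    have q2 : ∑ w ∈ W, (cN w * (y w - 1)) ≤ 0 := Finset.sum_nonpos fun w _ =>
      mul_nonpos_of_nonneg_of_nonpos (by positivity) (by linarith [hy1 w])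
    linarith
  obtain ⟨v₁, hv1, hc1⟩ := hex
  -- local bounds
  let s : V → ℝ := fun v => if 1 ≤ cN v then 1 / 4 else 0
  let g : V → ℝ := fun v => if 4 ≤ cN v then ((cN v : ℝ) / 2 - 1) else
    if 1 ≤ cN v then -(1 / 2) else 0
  have t1 : ∑ v ∈ N, (((cN v : ℝ) - 1) * y v - cN v / 2)
      ≤ ∑ v ∈ N, g v + ∑ v ∈ N, s v * ∑ w ∈ W, a v w * y w := by
    rw [← Finset.sum_add_distrib]
    refine Finset.sum_le_sum fun v hv => ?_
    refine local_N (cN v) (y v) _ (hy0 v).le (hy1 v)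
      (Finset.sum_nonneg fun w _ => mul_nonneg (a0 v w) (hy0 w).le) ?_
    have q1 := eN v hv
    have q2 : ∑ w ∈ N, a v w * y w ≤ cN v := by
      rw [← dN]
      exact Finset.sum_le_sum fun w _ => mul_le_of_le_one_right (a0 v w) (hy1 w)
    have q3 : 8 * y v ≤ lam * y v := mul_le_mul_of_nonneg_right hlam (hy0 v).le
    linarith
  let n1 : V → ℕ := fun w => (Finset.univ.filter fun c => (G.Adj u c ∧ G.Adj w c) ∧ 1 ≤ cN c).card
  have t2 : ∑ v ∈ N, s v * ∑ w ∈ W, a v w * y w = ∑ w ∈ W, n1 w * y w / 4 := by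
    have : ∀ v ∈ N, s v * ∑ w ∈ W, a v w * y w = ∑ w ∈ W, a v w * (s v * y w) := by
      intro v _; rw [Finset.mul_sum]; exact Finset.sum_congr rfl fun w _ => by ring
    rw [Finset.sum_congr rfl this, swap]
    refine Finset.sum_congr rfl fun w _ => ?_
    have : ∑ v ∈ N, a w v * s v = n1 w / 4 := by
      have : (n1 w : ℝ) = ∑ v ∈ N, if (G.Adj w v ∧ 1 ≤ cN v) then (1 : ℝ) else 0 := by
        simp [n1, hN, Finset.filter_filter, and_assoc]
      rw [this, Finset.sum_div]
      refine Finset.sum_congr rfl fun v _ => ?_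
      by_cases p : G.Adj w v
      · by_cases q : 1 ≤ cN v
        · simp [a1 _ _ p, s, p, q]
        · simp [s, q]
      · simp [an _ _ p, p]
    rw [Finset.sum_congr rfl (fun v _ => (by ring : a w v * (s v * y w) = a w v * s v * y w)),
      ← Finset.sum_mul, this]
    ring
  have locW : ∀ w ∈ W, (cN w : ℝ) * (y w - 1) + n1 w * y w / 4 ≤ 3 / 16 * cW w ∧
    (cW w ≤ 3 → (cN w : ℝ) * (y w - 1) + n1 w * y w / 4 ≤ 0) := by
    intro w hwW
    refine local_W _ _ _ lam (y w) (hy0 w).le (hy1 w) hlam ?_ ?_ ?_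
    · exact Finset.card_le_card fun z hz => by
        simp only [Finset.mem_filter] at hz ⊢
        exact ⟨hz.1, hz.2.1⟩
    · intro h
      obtain ⟨z, hz⟩ := Finset.card_pos.mp h
      simp only [Finset.mem_filter, Finset.mem_univ, true_and] at hz
      obtain ⟨d, hd1, hd2⟩ := cNex z hz.2
      rw [mW] at hwW
      exact card_le_three G hfree u w d z hwW.1 hd1 hz.1.1 hz.1.2 hd2
        (fun h => hwW.2 (h ▸ hd1))
    · rw [eW w hwW, ← dN, ← dW]
      exact add_le_add
        (Finset.sum_le_sum fun v _ => mul_le_of_le_one_right (a0 _ _) (hy1 v))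
        (Finset.sum_le_sum fun v _ => mul_le_of_le_one_right (a0 _ _) (hy1 v))
  have t3 : ∑ w ∈ W, (cN w * (y w - 1)) + ∑ w ∈ W, n1 w * y w / 4 - D / 2 ≤ -1 := by
    rw [← Finset.sum_add_distrib]
    by_cases hD4 : 4 ≤ D
    · have : ∑ w ∈ W, ((cN w : ℝ) * (y w - 1) + n1 w * y w / 4) ≤ 3 / 16 * D := by
        rw [hD, Finset.mul_sum]
        exact Finset.sum_le_sum fun w hw => (locW w hw).1
      linarith
    · have : ∑ w ∈ W, ((cN w : ℝ) * (y w - 1) + n1 w * y w / 4) ≤ 0 := by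
        refine Finset.sum_nonpos fun w hw => (locW w hw).2 ?_
        have : (cW w : ℝ) ≤ D :=
          Finset.single_le_sum (f := fun w => (cW w : ℝ)) (fun _ _ => by positivity) hw
        have : (cW w : ℝ) < 4 := by linarith
        have : cW w < 4 := by exact_mod_cast this
        omega
      linarith
  -- discharging in N
  have leaf : ∀ v z, v ∈ N → z ∈ N → G.Adj v z → 4 ≤ cN z → cN v = 1 := by
    intro v z hv hz hvz h4
    rw [mN] at hv hz
    refine le_antisymm ?_ (cNpos v z hz hvz)
    have : Nonempty V := ⟨z⟩
    refine Finset.card_le_one_iff_subset_singleton.mpr ⟨z, ?_⟩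
    intro d hd
    simp only [Finset.mem_filter, Finset.mem_univ, true_and] at hd
    rw [Finset.mem_singleton]
    by_contra hne
    have := card_le_three G hfree u z d v hz.ne' hd.1 hv hvz.symm hd.2 hne
    exact absurd h4 (by simp only [cN]; omega)
  let hi : V → ℝ := fun v => if 4 ≤ cN v then 1 else 0
  let h : V → ℝ := fun v => ∑ w ∈ N, a v w * hi w
  have hh : ∀ v, 0 ≤ h v ∧ h v ≤ cN v := by
    intro v
    constructor
    · exact Finset.sum_nonneg fun w _ => mul_nonneg (a0 _ _) (by simp only [hi]; split_ifs <;> norm_num)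
    · rw [← dN]
      exact Finset.sum_le_sum fun w _ => mul_le_of_le_one_right (a0 _ _)
        (by simp only [hi]; split_ifs <;> norm_num)
  have hz : ∀ v ∈ N, (h v = 0) ∨ cN v = 1 := by
    intro v hv
    by_cases hc : ∃ z ∈ N, G.Adj v z ∧ 4 ≤ cN z
    · obtain ⟨z, hz, hvz, h4⟩ := hc
      exact Or.inr (leaf v z hv hz hvz h4)
    · left
      push Not at hc
      refine Finset.sum_eq_zero fun z hz => ?_
      by_cases p : G.Adj v z
      · have := hc z hz p
        simp [hi, not_le.mpr this]
      · simp [an _ _ p]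
  let T : V → ℝ := fun v => h v / 2 - hi v - (if 1 ≤ cN v ∧ cN v < 4 then 1 / 2 else 0)
  have gT : ∑ v ∈ N, g v = ∑ v ∈ N, T v := by
    have r1 : ∑ v ∈ N, h v = ∑ v ∈ N, cN v * hi v := by
      simp only [h]
      rw [swap]
      simp only [← Finset.sum_mul, dN]
    have r2 : ∀ v, g v = cN v * hi v / 2 - hi v - (if 1 ≤ cN v ∧ cN v < 4 then 1 / 2 else 0) := by
      intro v
      simp only [g, hi]
      split_ifs <;> first | omega | ring
    have r3 : ∑ v ∈ N, h v / 2 = ∑ v ∈ N, cN v * hi v / 2 := by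
      rw [← Finset.sum_div, r1, Finset.sum_div]
    simp only [r2, T, Finset.sum_sub_distrib, r3]
  have Tle : ∀ v ∈ N, T v ≤ 0 := by
    intro v hv
    simp only [T]
    have hi0 : 0 ≤ hi v := by simp only [hi]; split_ifs <;> norm_num
    rcases hz v hv with q | q
    · rw [q]; split_ifs <;> linarith
    · have := (hh v).2
      rw [q] at this
      simp only [q]; norm_num at this ⊢; linarith
  have sumT : ∑ v ∈ N, T v ≤ -1 := by
    by_cases hc : ∃ z ∈ N, 4 ≤ cN z
    · obtain ⟨z, hzN, h4⟩ := hc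
      have hTz : T z = -1 := by
        have : h z = 0 := by
          rcases hz z hzN with q | q
          · exact q
          · omega
        simp only [T, this, hi, h4, if_true]
        rw [if_neg (by omega)]; norm_num
      have := Finset.sum_le_sum_of_subset_of_nonneg (f := fun v => - T v)
        (Finset.singleton_subset_iff.mpr hzN) (fun v hv _ => by linarith [Tle v hv])
      simp only [Finset.sum_singleton, Finset.sum_neg_distrib] at this
      linarith
    · push Not at hc
      obtain ⟨v₂, hv2, hadj⟩ := cNex v₁ hc1
      have hv2N : v₂ ∈ N := (mN _).2 hv2
      have hc2 : 1 ≤ cN v₂ := cNpos v₂ v₁ ((mN _).1 hv1) hadj.symm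
      have hT : ∀ v ∈ N, 1 ≤ cN v → T v = -(1 / 2) := by
        intro v hv h1
        have h0 : h v = 0 := Finset.sum_eq_zero fun z hz => by
          simp [hi, not_le.mpr (hc z hz)]
        have := hc v hv
        simp only [T, h0, hi]
        rw [if_neg (by omega), if_pos ⟨h1, this⟩]; norm_num
      have := Finset.sum_le_sum_of_subset_of_nonneg (f := fun v => - T v)
        (s := {v₁, v₂}) (t := N) (by intro z; simp only [Finset.mem_insert, Finset.mem_singleton]; rintro (rfl | rfl) <;> assumption)
        (fun v hv _ => by linarith [Tle v hv])
      rw [Finset.sum_pair hadj.ne, hT v₁ hv1 hc1, hT v₂ hv2N hc2, Finset.sum_neg_distrib] at this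
      linarith
  rw [gT, t2] at t1
  linarith

theorem stmt8 {V : Type*} [Fintype V] (G : SimpleGraph V) (m : ℕ)
    (hm : G.edgeSet.ncard = m) (hm57 : 57 ≤ m)
    (hfree : ¬ Contains theta223 G)
    (hiso : ∀ v : V, ∃ w, G.Adj v w)
    (lam : ℝ) (hlam : IsSpectralRadius G lam)
    (hmax : ∀ (n : ℕ) (H : SimpleGraph (Fin n)) (μ : ℝ),
      H.edgeSet.ncard = m → ¬ Contains theta223 H → (∀ v, ∃ w, H.Adj v w) →
      IsSpectralRadius H μ → μ ≤ lam)
    (x : V → ℝ) (hx : ∀ v, 0 < x v)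
    (heig : (adjMat G).mulVec x = lam • x)
    (ustar : V) (hustar : ∀ v, x v ≤ x ustar) :
    ∀ w₁ w₂ : V, w₁ ≠ ustar → ¬ G.Adj ustar w₁ →
      w₂ ≠ ustar → ¬ G.Adj ustar w₂ → ¬ G.Adj w₁ w₂ := by
  obtain ⟨h8, hlow⟩ := lam_lower m hm57 lam hmax
  intro w₁ w₂ h1 h1' h2 h2' hw
  have hu := hx ustar
  refine core_s8 G hfree lam h8 (by rw [hm]; exact hlow) (fun v => x v / x ustar)
    (fun v => div_pos (hx v) hu) (fun v => (div_le_one hu).2 (hustar v)) ?_ ustar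
    (div_self hu.ne') w₁ w₂ h1 h1' h2 h2' hw
  intro v
  have := congrFun heig v
  simp only [Matrix.mulVec, dotProduct, Pi.smul_apply, smul_eq_mul] at this
  rw [← mul_div_assoc, ← this, Finset.sum_div]
  exact Finset.sum_congr rfl fun w _ => by ring
end

section
/- Let m ≥ 57 and let G* attain the maximum spectral radius among all θ_{2,2,3}-free graphs with m edges and no isolated vertices. Let x be a positive eigenvector of the adjacency matrix of G* corresponding to λ(G*), let u* be a vertex maximizing the entries of x, and set U = N(u*). Then no connected component of the induced subgraph G*[U] is isomorphic to K_{1,3}+e. -/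
open SimpleGraph

theorem contains_theta_s9 {V : Type*} (G : SimpleGraph V) (a b c₁ c₂ d₁ d₂ : V)
    (h1 : G.Adj a c₁) (h2 : G.Adj c₁ b) (h3 : G.Adj a c₂) (h4 : G.Adj c₂ b)
    (h5 : G.Adj a d₁) (h6 : G.Adj d₁ d₂) (h7 : G.Adj d₂ b)
    (hab : a ≠ b) (hcc : c₁ ≠ c₂) (h8 : c₁ ≠ d₁) (h9 : c₁ ≠ d₂) (h10 : c₂ ≠ d₁) (h11 : c₂ ≠ d₂)
    (h12 : a ≠ d₂) (h13 : b ≠ d₁) : Contains theta223 G := by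
  have e1 := h1.ne
  have e2 := h2.ne
  have e3 := h3.ne
  have e4 := h4.ne
  have e5 := h5.ne
  have e6 := h6.ne
  have e7 := h7.ne
  refine ⟨⟨![a, b, c₁, c₂, d₁, d₂], ?_⟩, ?_⟩
  · rw [← List.nodup_ofFn]
    simp [List.ofFn_succ, e1, e3, e5, e2.symm, e4.symm, e7.symm, e6, hab, hcc, h8, h9, h10, h11,
      h12, h13]
  · intro i j hij
    simp only [theta223, SimpleGraph.fromRel_adj] at hij
    obtain ⟨-, h | h⟩ := hij <;>
    rcases h with h | h | h | h | h | h | h <;> obtain ⟨rfl, rfl⟩ := h <;>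
    simp [h1, h2, h3, h4, h5, h6, h7, h1.symm, h2.symm, h3.symm, h4.symm, h5.symm, h6.symm, h7.symm]

open Classical in
theorem core_s9 {V : Type*} [Fintype V] (G : SimpleGraph V) (m : ℝ)
    (hm : ∑ v, (G.degree v : ℝ) = 2 * m)
    (hfree : ¬ Contains theta223 G)
    (lam : ℝ) (hl : 7 < lam) (hlm : m - 2 ≤ lam ^ 2 - lam)
    (x : V → ℝ) (hx : ∀ v, 0 < x v) (u : V) (hu : x u = 1) (hx1 : ∀ v, x v ≤ 1)
    (heig : ∀ v, lam * x v = ∑ w, if G.Adj v w then x w else 0)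
    (p0 p1 p2 p3 : V)
    (hp0 : G.Adj u p0) (hp1 : G.Adj u p1) (hp2 : G.Adj u p2) (hp3 : G.Adj u p3)
    (h01 : p0 ≠ p1) (h02 : p0 ≠ p2) (h03 : p0 ≠ p3) (h12 : p1 ≠ p2) (h13 : p1 ≠ p3) (h23 : p2 ≠ p3)
    (hN0 : ∀ v, G.Adj u v → (G.Adj p0 v ↔ v = p1 ∨ v = p2 ∨ v = p3))
    (hN1 : ∀ v, G.Adj u v → (G.Adj p1 v ↔ v = p0 ∨ v = p2))
    (hN2 : ∀ v, G.Adj u v → (G.Adj p2 v ↔ v = p0 ∨ v = p1))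
    (hN3 : ∀ v, G.Adj u v → (G.Adj p3 v ↔ v = p0)) : False := by
  set U : Finset V := Finset.univ.filter (fun v => G.Adj u v) with hU
  set W : Finset V := Finset.univ.filter (fun v => v ≠ u ∧ ¬ G.Adj u v) with hW
  have memU : ∀ v, v ∈ U ↔ G.Adj u v := by intro v; simp [hU]
  have memW : ∀ v, v ∈ W ↔ v ≠ u ∧ ¬ G.Adj u v := by intro v; simp [hW]
  have split : ∀ f : V → ℝ, ∑ v, f v = f u + ∑ v ∈ U, f v + ∑ v ∈ W, f v := by
    intro f
    rw [← Finset.sum_filter_add_sum_filter_not Finset.univ (fun v => G.Adj u v)]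
    have : Finset.univ.filter (fun v => ¬ G.Adj u v) = insert u W := by
      ext v
      by_cases h : v = u <;> simp [memW, h]
    rw [this, Finset.sum_insert (by simp [memW])]
    ring
  let N : V → Finset V := fun v => U.filter (fun w => G.Adj v w)
  let M : V → Finset V := fun v => W.filter (fun w => G.Adj v w)
  have memN : ∀ v w, w ∈ N v ↔ G.Adj u w ∧ G.Adj v w := by intro v w; simp [N, memU]
  let d : V → ℝ := fun v => ((N v).card : ℝ)
  let e : V → ℝ := fun v => ((M v).card : ℝ)
  have d_nonneg : ∀ v, 0 ≤ d v := fun v => Nat.cast_nonneg _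
  have e_nonneg : ∀ v, 0 ≤ e v := fun v => Nat.cast_nonneg _
  have d_sum : ∀ v, d v = ∑ w ∈ U, if G.Adj v w then (1:ℝ) else 0 := by
    intro v; simp [d, N]
  have e_sum : ∀ v, e v = ∑ w ∈ W, if G.Adj v w then (1:ℝ) else 0 := by
    intro v; simp [e, M]
  -- eigen equations
  have eigU : ∀ v ∈ U, lam * x v = 1 + ∑ w ∈ N v, x w + ∑ w ∈ M v, x w := by
    intro v hv
    rw [heig, split, if_pos ((memU v).1 hv).symm, hu]
    simp [N, M, Finset.sum_filter]
  have eigW : ∀ v ∈ W, lam * x v = ∑ w ∈ N v, x w + ∑ w ∈ M v, x w := by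
    intro v hv
    rw [heig, split, if_neg (fun h => ((memW v).1 hv).2 h.symm)]
    simp [N, M, Finset.sum_filter]
  have eigu : lam = ∑ v ∈ U, x v := by
    have := heig u
    rw [hu, mul_one] at this
    rw [this, hU, Finset.sum_filter]
  have sumN : ∀ v, ∑ w ∈ N v, x w ≤ d v := by
    intro v
    calc ∑ w ∈ N v, x w ≤ ∑ w ∈ N v, (1:ℝ) := Finset.sum_le_sum (fun i _ => hx1 i)
      _ = d v := by simp [d]
  have sumM : ∀ v, ∑ w ∈ M v, x w ≤ e v := by
    intro v
    calc ∑ w ∈ M v, x w ≤ ∑ w ∈ M v, (1:ℝ) := Finset.sum_le_sum (fun i _ => hx1 i)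
      _ = e v := by simp [e]
  -- swapping
  have swapU : ∀ f : V → ℝ, ∑ v ∈ U, ∑ w ∈ N v, f w = ∑ w ∈ U, d w * f w := by
    intro f
    simp only [N, Finset.sum_filter]
    rw [Finset.sum_comm]
    refine Finset.sum_congr rfl fun w _ => ?_
    rw [d_sum, Finset.sum_mul]
    refine Finset.sum_congr rfl fun v _ => ?_
    simp [G.adj_comm v w]
  have swapUW : ∀ g : V → V → ℝ, ∑ v ∈ U, ∑ w ∈ M v, g v w = ∑ w ∈ W, ∑ v ∈ N w, g v w := by
    intro g
    simp only [N, M, Finset.sum_filter]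
    rw [Finset.sum_comm]
    simp only [G.adj_comm]
  have lam2 : lam ^ 2 = (U.card : ℝ) + ∑ v ∈ U, d v * x v + ∑ w ∈ W, d w * x w := by
    have : lam ^ 2 = ∑ v ∈ U, lam * x v := by rw [← Finset.mul_sum, ← eigu]; ring
    rw [this, Finset.sum_congr rfl eigU, Finset.sum_add_distrib, Finset.sum_add_distrib,
      swapU x, swapUW (fun _ w => x w)]
    simp [d]
  have hdeg : ∀ v, (G.degree v : ℝ) = (if G.Adj v u then 1 else 0) + d v + e v := by
    intro v
    rw [d_sum, e_sum, ← split (fun w => if G.Adj v w then (1:ℝ) else 0)]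
    simp [← G.card_neighborFinset_eq_degree, G.neighborFinset_eq_filter]
  have m2 : 2 * m = 2 * (U.card : ℝ) + ∑ v ∈ U, d v + 2 * ∑ w ∈ W, d w + ∑ w ∈ W, e w := by
    rw [← hm, split]
    have a1 : (G.degree u : ℝ) = U.card := by
      simp [hU, ← G.card_neighborFinset_eq_degree, G.neighborFinset_eq_filter]
    have a2 : ∑ v ∈ U, (G.degree v : ℝ) = U.card + ∑ v ∈ U, d v + ∑ w ∈ W, d w := by
      have h1 : ∑ v ∈ U, (G.degree v : ℝ) = ∑ v ∈ U, (1 + d v + e v) := by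
        refine Finset.sum_congr rfl fun v hv => ?_
        rw [hdeg, if_pos ((memU v).1 hv).symm]
      have h2 : ∑ v ∈ U, e v = ∑ w ∈ W, d w := by
        have := swapUW (fun _ _ => 1)
        simpa [d, e] using this
      rw [h1, Finset.sum_add_distrib, Finset.sum_add_distrib, h2]
      simp
    have a3 : ∑ v ∈ W, (G.degree v : ℝ) = ∑ w ∈ W, d w + ∑ w ∈ W, e w := by
      rw [← Finset.sum_add_distrib]
      refine Finset.sum_congr rfl fun v hv => ?_
      rw [hdeg, if_neg (fun h => ((memW v).1 hv).2 h.symm)]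
      ring
    rw [a1, a2, a3]; ring
  -- star centres
  let S : V → Prop := fun v => 3 ≤ (N v).card ∧ ∀ w ∈ N v, (N w).card = 1
  let σ : V → ℝ := fun v => if S v then 1 else 0
  have hNsymm : ∀ v w, v ∈ U → w ∈ N v → v ∈ N w := by
    intro v w hv hw
    rw [memN] at hw ⊢
    exact ⟨(memU v).1 hv, hw.2.symm⟩
  -- redistribution
  have redis : ∑ v ∈ U, ∑ w ∈ N v, (1 + σ v - σ w) / 2 = ∑ v ∈ U, d v / 2 := by
    have h1 : ∀ v ∈ U, ∑ w ∈ N v, (1 + σ v - σ w) / 2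
        = d v / 2 + d v * σ v / 2 - (∑ w ∈ N v, σ w) / 2 := by
      intro v _
      rw [← Finset.sum_div, Finset.sum_sub_distrib, Finset.sum_const, nsmul_eq_mul]
      simp only [d]; ring
    rw [Finset.sum_congr rfl h1, Finset.sum_sub_distrib, Finset.sum_add_distrib,
      ← Finset.sum_div _ _ (2:ℝ), ← Finset.sum_div _ _ (2:ℝ), ← Finset.sum_div _ _ (2:ℝ), swapU σ]
    ring
  have main : lam ^ 2 - lam - m = ∑ v ∈ U, ((d v - 1) * x v - ∑ w ∈ N v, (1 + σ v - σ w) / 2)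
      - ∑ w ∈ W, (d w * (1 - x w) + e w / 2) := by
    rw [Finset.sum_sub_distrib, redis]
    have e1 : ∑ v ∈ U, (d v - 1) * x v = ∑ v ∈ U, d v * x v - lam := by
      rw [eigu, ← Finset.sum_sub_distrib]
      exact Finset.sum_congr rfl fun _ _ => by ring
    have e2 : ∑ w ∈ W, (d w * (1 - x w) + e w / 2)
        = ∑ w ∈ W, d w - ∑ w ∈ W, d w * x w + (∑ w ∈ W, e w) / 2 := by
      rw [Finset.sum_add_distrib, ← Finset.sum_div, ← Finset.sum_sub_distrib]
      congr 1
      exact Finset.sum_congr rfl fun _ _ => by ring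
    rw [e1, e2, ← Finset.sum_div]
    linarith
  have hlpos : 0 < lam := by linarith
  -- neighbourhoods of the four vertices
  have N0 : N p0 = {p1, p2, p3} := by
    ext v; rw [memN]; simp only [Finset.mem_insert, Finset.mem_singleton]
    constructor
    · rintro ⟨a, b⟩; exact (hN0 v a).1 b
    · intro h
      have hv : G.Adj u v := by rcases h with rfl | rfl | rfl <;> assumption
      exact ⟨hv, (hN0 v hv).2 h⟩
  have N1 : N p1 = {p0, p2} := by
    ext v; rw [memN]; simp only [Finset.mem_insert, Finset.mem_singleton]
    constructor
    · rintro ⟨a, b⟩; exact (hN1 v a).1 b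
    · intro h
      have hv : G.Adj u v := by rcases h with rfl | rfl <;> assumption
      exact ⟨hv, (hN1 v hv).2 h⟩
  have N2 : N p2 = {p0, p1} := by
    ext v; rw [memN]; simp only [Finset.mem_insert, Finset.mem_singleton]
    constructor
    · rintro ⟨a, b⟩; exact (hN2 v a).1 b
    · intro h
      have hv : G.Adj u v := by rcases h with rfl | rfl <;> assumption
      exact ⟨hv, (hN2 v hv).2 h⟩
  have N3 : N p3 = {p0} := by
    ext v; rw [memN]; simp only [Finset.mem_singleton]
    constructor
    · rintro ⟨a, b⟩; exact (hN3 v a).1 b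
    · intro h
      have hv : G.Adj u v := by rcases h with rfl; assumption
      exact ⟨hv, (hN3 v hv).2 h⟩
  have c0 : (N p0).card = 3 := by
    rw [N0]; exact Finset.card_eq_three.2 ⟨_, _, _, h12, h13, h23, rfl⟩
  have c1 : (N p1).card = 2 := by rw [N1]; exact Finset.card_pair h02
  have c2 : (N p2).card = 2 := by rw [N2]; exact Finset.card_pair h01
  have c3 : (N p3).card = 1 := by rw [N3]; simp
  have S0 : ¬ S p0 := by
    rintro ⟨-, h⟩
    have := h p1 (by rw [N0]; simp)
    omega
  -- weights
  let s : V → ℝ := fun v => if S v then 0 else if 3 ≤ (N v).card then 2 else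
    if v = p1 ∨ v = p2 then 1 else 0
  let b : V → ℝ := fun v => (if v = p0 then 3/2 - 8/lam else 0) + (if v = p1 then 1 - 3/lam else 0)
    + (if v = p2 then 1 - 3/lam else 0) + (if v = p3 then 1/2 else 0)
  have hUb : ∀ v ∈ U, (d v - 1) * x v - ∑ w ∈ N v, (1 + σ v - σ w) / 2
      ≤ - b v + s v / lam * ∑ w ∈ M v, x w := by
    intro v hv
    have hvu : G.Adj u v := (memU v).1 hv
    have hxv := hx v
    have hxv1 := hx1 v
    have hMn : 0 ≤ ∑ w ∈ M v, x w := Finset.sum_nonneg fun w _ => (hx w).le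
    have σnn : ∀ w, 0 ≤ σ w := fun w => by simp only [σ]; split_ifs <;> norm_num
    have σle : ∀ w, σ w ≤ 1 := fun w => by simp only [σ]; split_ifs <;> norm_num
    have αnn : 0 ≤ ∑ w ∈ N v, (1 + σ v - σ w) / 2 := by
      refine Finset.sum_nonneg fun w _ => ?_
      have := σnn v
      have := σle w
      linarith
    -- no star centre next to a vertex of degree other than one
    have hnS : (N v).card ≠ 1 → ∀ w ∈ N v, ¬ S w := by
      intro hc w hw hS
      exact hc (hS.2 v (hNsymm v w hv hw))
    have αhalf : ¬ S v → (∀ w ∈ N v, ¬ S w) → ∑ w ∈ N v, (1 + σ v - σ w) / 2 = d v / 2 := by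
      intro h1 h2
      have : ∀ w ∈ N v, (1 + σ v - σ w) / 2 = (1:ℝ) / 2 := by
        intro w hw
        simp [σ, h1, h2 w hw]
      rw [Finset.sum_congr rfl this, Finset.sum_const, nsmul_eq_mul]
      simp only [d]; ring
    have hb0 : v ≠ p0 → v ≠ p1 → v ≠ p2 → v ≠ p3 → b v = 0 := by
      intro a1 a2 a3 a4
      simp [b, a1, a2, a3, a4]
    have eq := eigU v hv
    have hsn := sumN v
    by_cases hS : S v
    · have hs : s v = 0 := by simp [s, hS]
      have hb : b v = 0 := by
        apply hb0
        · rintro rfl; exact S0 hS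
        · rintro rfl; have := hS.1; omega
        · rintro rfl; have := hS.1; omega
        · rintro rfl; have := hS.1; omega
      have h1 : ∑ w ∈ N v, (1 + σ v - σ w) / 2 = d v := by
        have : ∀ w ∈ N v, (1 + σ v - σ w) / 2 = (1:ℝ) := by
          intro w hw
          have : ¬ S w := by
            intro h
            have := hS.2 w hw
            have := h.1
            omega
          simp [σ, hS, this]
        rw [Finset.sum_congr rfl this]
        simp [d]
      rw [hs, hb, h1, zero_div, zero_mul]
      have h3 : (3:ℝ) ≤ d v := by simp only [d]; exact_mod_cast hS.1
      nlinarith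
    by_cases h3 : 3 ≤ (N v).card
    · have hs : s v = 2 := by simp [s, hS, h3]
      have hcard : (N v).card = 3 := by
        by_contra hne
        have h4 : 4 ≤ (N v).card := by omega
        have : ∃ w ∈ N v, (N w).card ≠ 1 := by
          by_contra hcon
          push Not at hcon
          exact hS ⟨h3, hcon⟩
        obtain ⟨w, hw, hwc⟩ := this
        have hvw := hNsymm v w hv hw
        have : ∃ z ∈ N w, z ≠ v := by
          by_contra hcon
          push Not at hcon
          apply hwc
          rw [Finset.card_eq_one]
          refine ⟨v, ?_⟩
          ext z
          simp only [Finset.mem_singleton]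
          exact ⟨hcon z, fun h => h ▸ hvw⟩
        obtain ⟨z, hz, hzv⟩ := this
        have hc2 : 1 < (((N v).erase w).erase z).card := by
          have a1 := Finset.card_erase_of_mem hw
          have a2 := Finset.pred_card_le_card_erase (s := (N v).erase w) (a := z)
          omega
        obtain ⟨q, hq, r, hr, hqr⟩ := Finset.one_lt_card.1 hc2
        simp only [Finset.mem_erase, memN] at hq hr hw hz
        obtain ⟨q1, q2, q3, q4⟩ := hq
        obtain ⟨r1, r2, r3, r4⟩ := hr
        exact hfree (contains_theta_s9 G u v q r z w q3 q4.symm r3 r4.symm hz.1 hz.2.symm hw.2.symm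
          hvu.ne hqr q1 q2 r1 r2 hw.1.ne hzv.symm)
      have hd : d v = 3 := by simp only [d]; rw [hcard]; norm_num
      rw [αhalf hS (hnS (by omega)), hs, hd]
      have hb : b v ≤ 3/2 - 8/lam := by
        by_cases h0 : v = p0
        · subst h0
          simp [b, h01, h02, h03]
        · rw [hb0 h0]
          · have : 8/lam ≤ 3/2 := by rw [div_le_iff₀ hlpos]; linarith
            linarith
          · rintro rfl; omega
          · rintro rfl; omega
          · rintro rfl; omega
      have hxb : x v ≤ 4 / lam + 1/lam * ∑ w ∈ M v, x w := by
        have : x v = (lam * x v) / lam := by field_simp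
        rw [this, ← mul_comm (∑ w ∈ M v, x w), mul_one_div, ← add_div]
        apply div_le_div_of_nonneg_right _ hlpos.le
        linarith
      have e1 : (2:ℝ)/lam = 2 * (1/lam) := by ring
      have e2 : (8:ℝ)/lam = 2 * (4/lam) := by ring
      rw [e1]
      rw [e2] at hb
      nlinarith
    by_cases h12' : v = p1 ∨ v = p2
    · have hs : s v = 1 := by simp [s, hS, h3, h12']
      have hcard : (N v).card = 2 := by rcases h12' with rfl | rfl <;> assumption
      have hd : d v = 2 := by simp only [d]; rw [hcard]; norm_num
      have hb : b v = 1 - 3/lam := by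
        rcases h12' with rfl | rfl
        · simp [b, h01.symm, h12, h13]
        · simp [b, h02.symm, h12.symm, h23]
      rw [αhalf hS (hnS (by omega)), hs, hd, hb]
      have hxb : x v ≤ 3 / lam + 1/lam * ∑ w ∈ M v, x w := by
        have : x v = (lam * x v) / lam := by field_simp
        rw [this, ← mul_comm (∑ w ∈ M v, x w), mul_one_div, ← add_div]
        apply div_le_div_of_nonneg_right _ hlpos.le
        linarith
      linarith
    push Not at h12'
    have hs : s v = 0 := by simp [s, hS, h3, h12']
    have hv0 : v ≠ p0 := by rintro rfl; omega
    rw [hs, zero_div, zero_mul]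
    by_cases hv3 : v = p3
    · have hb : b v = 1/2 := by
        subst hv3
        simp [b, h03.symm, h13.symm, h23.symm]
      have hd : d v = 1 := by subst hv3; simp only [d]; rw [c3]; norm_num
      have : ∀ w ∈ N v, ¬ S w := by
        subst hv3
        rw [N3]
        intro w hw
        rw [Finset.mem_singleton.1 hw]
        exact S0
      rw [αhalf hS this, hb, hd]
      linarith
    · rw [hb0 hv0 h12'.1 h12'.2 hv3]
      have : (N v).card = 0 ∨ (N v).card = 1 ∨ (N v).card = 2 := by omega
      rcases this with h | h | h
      · have hd : d v = 0 := by simp only [d]; rw [h]; norm_num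
        rw [hd]; linarith
      · have hd : d v = 1 := by simp only [d]; rw [h]; norm_num
        rw [hd]; linarith
      · have hd : d v = 2 := by simp only [d]; rw [h]; norm_num
        rw [αhalf hS (hnS (by omega)), hd]; linarith
  have hWb : ∀ w ∈ W, ∑ v ∈ N w, s v / lam * x w ≤ d w * (1 - x w) + e w / 2 := by
    intro w hw
    obtain ⟨hwu, hwn⟩ := (memW w).1 hw
    have hxw := hx w
    have hxw1 := hx1 w
    have eq := eigW w hw
    have hsN := sumN w
    have hsM := sumM w
    have hen := e_nonneg w
    have snn : ∀ v, 0 ≤ s v := fun v => by simp only [s]; split_ifs <;> norm_num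
    have sle : ∀ v, s v ≤ 2 := fun v => by simp only [s]; split_ifs <;> norm_num
    have hrew : ∑ v ∈ N w, s v / lam * x w = (∑ v ∈ N w, s v) / lam * x w := by
      rw [Finset.sum_div, Finset.sum_mul]
    rw [hrew]
    have hdn := d_nonneg w
    -- numeric conclusions
    have fin : (∑ v ∈ N w, s v ≤ 2) → (d w = 1 ∨ d w = 2) →
        (∑ v ∈ N w, s v) / lam * x w ≤ d w * (1 - x w) + e w / 2 := by
      intro h1 h2
      have h3 : (∑ v ∈ N w, s v) / lam ≤ 2 / 7 := by
        rw [div_le_div_iff₀ hlpos (by norm_num)]; linarith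
      have h4 : (∑ v ∈ N w, s v) / lam * x w ≤ 2 / 7 * x w :=
        mul_le_mul_of_nonneg_right h3 hxw.le
      have h5 : 7 * x w ≤ lam * x w := mul_le_mul_of_nonneg_right hl.le hxw.le
      rcases h2 with h2 | h2 <;> rw [h2] at hsN ⊢ <;> linarith
    by_cases hbig : ∃ v ∈ N w, 3 ≤ (N v).card
    · obtain ⟨v, hv, hv3⟩ := hbig
      have hv' := (memN w v).1 hv
      have hone : N w = {v} := by
        ext z
        simp only [Finset.mem_singleton]
        refine ⟨fun hz => ?_, fun h => h ▸ hv⟩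
        by_contra hzv
        have hz' := (memN w z).1 hz
        have hc2 : 1 < ((N v).erase z).card := by
          have a2 := Finset.pred_card_le_card_erase (s := N v) (a := z)
          omega
        obtain ⟨q, hq, r, hr, hqr⟩ := Finset.one_lt_card.1 hc2
        simp only [Finset.mem_erase, memN] at hq hr
        obtain ⟨q1, q2, q3⟩ := hq
        obtain ⟨r1, r2, r3⟩ := hr
        exact hfree (contains_theta_s9 G v u q r w z q3 q2.symm r3 r2.symm hv'.2.symm hz'.2 hz'.1.symm
          hv'.1.ne.symm hqr (fun h => hwn (h ▸ q2)) q1 (fun h => hwn (h ▸ r2)) r1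
          (fun h => hzv h.symm) hwu.symm)
      apply fin
      · rw [hone, Finset.sum_singleton]; exact sle v
      · left; simp [d, hone]
    push Not at hbig
    by_cases hp : p1 ∈ N w ∨ p2 ∈ N w
    · have hsub : N w ⊆ {p1, p2} := by
        intro z hz
        have hz' := (memN w z).1 hz
        have hz0 : z ≠ p0 := by
          rintro rfl
          have := hbig _ hz
          omega
        by_contra hcon
        simp only [Finset.mem_insert, Finset.mem_singleton, not_or] at hcon
        have a01 : G.Adj p0 p1 := (hN0 p1 hp1).2 (Or.inl rfl)
        have a02 : G.Adj p0 p2 := (hN0 p2 hp2).2 (Or.inr (Or.inl rfl))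
        have a12 : G.Adj p1 p2 := (hN1 p2 hp2).2 (Or.inr rfl)
        have w0 : p0 ≠ w := fun h => hwn (h ▸ hp0)
        have w1 : p1 ≠ w := fun h => hwn (h ▸ hp1)
        have w2 : p2 ≠ w := fun h => hwn (h ▸ hp2)
        rcases hp with h | h
        · have h' := (memN w p1).1 h
          exact hfree (contains_theta_s9 G p1 u p0 p2 w z a01.symm hp0.symm a12 hp2.symm h'.2.symm
            hz'.2 hz'.1.symm hp1.ne.symm h02 w0 hz0.symm w2 (Ne.symm hcon.2) (Ne.symm hcon.1)
            hwu.symm)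
        · have h' := (memN w p2).1 h
          exact hfree (contains_theta_s9 G p2 u p0 p1 w z a02.symm hp0.symm a12.symm hp1.symm
            h'.2.symm hz'.2 hz'.1.symm hp2.ne.symm h01 w0 hz0.symm w1 (Ne.symm hcon.1)
            (Ne.symm hcon.2) hwu.symm)
      have hcle : (N w).card ≤ 2 := (Finset.card_le_card hsub).trans Finset.card_le_two
      have hcpos : 0 < (N w).card := by
        rcases hp with h | h <;> exact Finset.card_pos.2 ⟨_, h⟩
      have hs1 : ∑ v ∈ N w, s v ≤ d w := by
        calc ∑ v ∈ N w, s v ≤ ∑ v ∈ N w, (1:ℝ) := by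
              refine Finset.sum_le_sum fun v hv => ?_
              have := hbig v hv
              have h3 : ¬ 3 ≤ (N v).card := by omega
              simp only [s, h3, if_false]
              split_ifs <;> norm_num
          _ = d w := by simp [d]
      have hd2 : d w ≤ 2 := by simp only [d]; exact_mod_cast hcle
      apply fin (hs1.trans hd2)
      have : (N w).card = 1 ∨ (N w).card = 2 := by omega
      rcases this with h | h
      · left; simp [d, h]
      · right; simp [d, h]
    push Not at hp
    have hs0 : ∑ v ∈ N w, s v = 0 := by
      refine Finset.sum_eq_zero fun v hv => ?_
      have := hbig v hv
      have h3 : ¬ 3 ≤ (N v).card := by omega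
      have h1 : v ≠ p1 := by rintro rfl; exact hp.1 hv
      have h2 : v ≠ p2 := by rintro rfl; exact hp.2 hv
      simp [s, h3, h1, h2]
    rw [hs0, zero_div, zero_mul]
    have : 0 ≤ d w * (1 - x w) := mul_nonneg hdn (by linarith)
    linarith
  have hbsum : ∑ v ∈ U, b v = 4 - 14 / lam := by
    simp only [b, Finset.sum_add_distrib, Finset.sum_ite_eq', memU, hp0, hp1, hp2, hp3, if_true]
    ring
  have k1 := Finset.sum_le_sum hUb
  have k2 := Finset.sum_le_sum hWb
  have k3 : ∑ v ∈ U, (- b v + s v / lam * ∑ w ∈ M v, x w)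
      = - ∑ v ∈ U, b v + ∑ w ∈ W, ∑ v ∈ N w, s v / lam * x w := by
    rw [Finset.sum_add_distrib, Finset.sum_neg_distrib, ← swapUW (fun v w => s v / lam * x w)]
    simp only [Finset.mul_sum]
  have k4 : 14 / lam < 2 := by rw [div_lt_iff₀ hlpos]; linarith
  linarith

theorem exists_spectralRadius {n : ℕ} (H : SimpleGraph (Fin n)) (v : Fin n → ℝ) (t : ℝ)
    (hv : v ≠ 0) (hv' : ∀ i, v i * (adjMat H).mulVec v i = t * (v i * v i)) :
    ∃ μ, IsSpectralRadius H μ ∧ t ≤ μ := by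
  classical
  have hA : (adjMat H).IsHermitian := by
    ext i j
    simp [adjMat, H.adj_comm]
  have hS := Matrix.isSymmetric_toEuclideanLin_iff.mpr hA
  set T := (adjMat H).toEuclideanLin with hT
  have hv0 : WithLp.toLp 2 v ≠ 0 := by
    intro h
    apply hv
    simpa using congrArg WithLp.ofLp h
  have : Nontrivial (EuclideanSpace ℝ (Fin n)) := ⟨⟨_, _, hv0⟩⟩
  have hev := hS.hasEigenvalue_iSup_of_finiteDimensional
  set μ : ℝ := ⨆ x : { x : EuclideanSpace ℝ (Fin n) // x ≠ 0 },
    RCLike.re (inner ℝ (T x) x) / ‖(x : EuclideanSpace ℝ (Fin n))‖ ^ 2 with hμ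
  have hbdd : BddAbove (Set.range fun x : { x : EuclideanSpace ℝ (Fin n) // x ≠ 0 } =>
      RCLike.re (inner ℝ (T x) (x : EuclideanSpace ℝ (Fin n))) /
        ‖(x : EuclideanSpace ℝ (Fin n))‖ ^ 2) := by
    refine ⟨‖T.toContinuousLinearMap‖, ?_⟩
    rintro _ ⟨x, rfl⟩
    have hx : 0 < ‖(x : EuclideanSpace ℝ (Fin n))‖ := norm_pos_iff.2 x.2
    simp only
    rw [div_le_iff₀ (by positivity)]
    have h1 := real_inner_le_norm (T x) (x : EuclideanSpace ℝ (Fin n))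
    have h2 := T.toContinuousLinearMap.le_opNorm (x : EuclideanSpace ℝ (Fin n))
    simp only [LinearMap.coe_toContinuousLinearMap'] at h2
    simp only [RCLike.re_to_real]
    nlinarith
  have hray : ∀ (w : Fin n → ℝ) (r : ℝ), w ≠ 0 →
      (∀ i, w i * (adjMat H).mulVec w i = r * (w i * w i)) → r ≤ μ := by
    intro w r hw hr
    have hw0 : WithLp.toLp 2 w ≠ 0 := by
      intro h
      apply hw
      simpa using congrArg WithLp.ofLp h
    have h1 := le_ciSup hbdd ⟨WithLp.toLp 2 w, hw0⟩
    refine le_trans (le_of_eq ?_) h1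
    have hpos : 0 < ‖WithLp.toLp 2 w‖ := norm_pos_iff.2 hw0
    simp only [RCLike.re_to_real]
    rw [eq_div_iff (by positivity), EuclideanSpace.norm_sq_eq, PiLp.inner_apply, Finset.mul_sum]
    refine Finset.sum_congr rfl fun i _ => ?_
    have := hr i
    simp [hT, Matrix.toEuclideanLin, pow_two] at this ⊢
    linarith
  refine ⟨μ, ⟨?_, ?_⟩, hray v t hv hv'⟩
  · obtain ⟨w, hw⟩ := hev.exists_hasEigenvector
    refine ⟨w.ofLp, ?_, ?_⟩
    · intro h
      apply hw.2
      ext i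
      simp [h]
    · have := hw.apply_eq_smul
      simpa [hT, Matrix.toEuclideanLin] using congrArg WithLp.ofLp this
  · intro r w hw hr
    refine hray w r hw fun i => ?_
    rw [hr]
    simp
    ring

/-- The book graph with `k` pages and `ε` pendant edges at one of its two hubs. -/
def bookG (k ε : ℕ) : SimpleGraph (Fin (k + ε + 2)) :=
  SimpleGraph.fromRel (fun x y => x.val = 0 ∨ (x.val = 1 ∧ y.val < k + 2))

theorem bookG_adj (k ε : ℕ) (x y : Fin (k + ε + 2)) : (bookG k ε).Adj x y ↔ x.val ≠ y.val ∧
    (x.val = 0 ∨ y.val = 0 ∨ (x.val = 1 ∧ y.val < k + 2) ∨ (y.val = 1 ∧ x.val < k + 2)) := by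
  simp only [bookG, SimpleGraph.fromRel_adj, ne_eq, Fin.ext_iff]
  tauto

theorem bookG_free (k ε : ℕ) : ¬ Contains theta223 (bookG k ε) := by
  rintro ⟨f, hf⟩
  have h1 : (bookG k ε).Adj (f 0) (f 2) := hf (by simp [theta223])
  have h2 : (bookG k ε).Adj (f 3) (f 1) := hf (by simp [theta223])
  have h3 : (bookG k ε).Adj (f 4) (f 5) := hf (by simp [theta223])
  rw [bookG_adj] at h1 h2 h3
  have inj : ∀ i j : Fin 6, i ≠ j → (f i).val ≠ (f j).val := by
    intro i j hij h
    exact hij (f.injective (Fin.ext h))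
  have := inj 0 3 (by decide)
  have := inj 0 1 (by decide)
  have := inj 0 4 (by decide)
  have := inj 0 5 (by decide)
  have := inj 2 3 (by decide)
  have := inj 2 1 (by decide)
  have := inj 2 4 (by decide)
  have := inj 2 5 (by decide)
  have := inj 3 4 (by decide)
  have := inj 3 5 (by decide)
  have := inj 1 4 (by decide)
  have := inj 1 5 (by decide)
  omega

theorem bookG_iso (k ε : ℕ) (v : Fin (k + ε + 2)) : ∃ w, (bookG k ε).Adj v w := by
  by_cases h : v.val = 0
  · refine ⟨⟨1, by omega⟩, ?_⟩
    rw [bookG_adj]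
    simp [h]
  · refine ⟨⟨0, by omega⟩, ?_⟩
    rw [bookG_adj]
    simp [h]

theorem bookG_edges (k ε : ℕ) : (bookG k ε).edgeSet.ncard = 2 * k + 1 + ε := by
  let g : Fin (k + ε + 1) ⊕ Fin k → Sym2 (Fin (k + ε + 2)) := fun z => match z with
    | Sum.inl j => s(⟨0, by omega⟩, ⟨j.val + 1, by omega⟩)
    | Sum.inr j => s(⟨1, by omega⟩, ⟨j.val + 2, by omega⟩)
  have hg : Function.Injective g := by
    rintro (i | i) (j | j) h <;> rcases Sym2.eq_iff.1 h with ⟨h1, h2⟩ | ⟨h1, h2⟩ <;>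
      replace h1 := Fin.val_eq_of_eq h1 <;> replace h2 := Fin.val_eq_of_eq h2 <;>
      dsimp only at h1 h2 <;>
      first
      | (exfalso; omega)
      | exact congrArg Sum.inl (Fin.ext (by omega))
      | exact congrArg Sum.inr (Fin.ext (by omega))
  have hr : (bookG k ε).edgeSet = Set.range g := by
    ext e
    induction e using Sym2.ind with
    | _ a b =>
    rw [SimpleGraph.mem_edgeSet, bookG_adj]
    have key : ∀ a b : Fin (k + ε + 2), a.val ≠ b.val →
        (a.val = 0 ∨ (a.val = 1 ∧ b.val < k + 2)) → s(a, b) ∈ Set.range g := by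
      intro a b hne h
      by_cases h0 : a.val = 0
      · refine ⟨Sum.inl ⟨b.val - 1, by omega⟩, ?_⟩
        simp only [g, Sym2.eq_iff, Fin.ext_iff]
        omega
      by_cases hb0 : b.val = 0
      · refine ⟨Sum.inl ⟨a.val - 1, by omega⟩, ?_⟩
        simp only [g, Sym2.eq_iff, Fin.ext_iff]
        omega
      · refine ⟨Sum.inr ⟨b.val - 2, by omega⟩, ?_⟩
        simp only [g, Sym2.eq_iff, Fin.ext_iff]
        omega
    constructor
    · rintro ⟨hne, h⟩
      by_cases h' : a.val = 0 ∨ (a.val = 1 ∧ b.val < k + 2)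
      · exact key a b hne h'
      · rw [Sym2.eq_swap]
        exact key b a hne.symm (by tauto)
    · rintro ⟨z | z, hz⟩
      · simp only [g, Sym2.eq_iff, Fin.ext_iff] at hz
        omega
      · simp only [g, Sym2.eq_iff, Fin.ext_iff] at hz
        omega
  rw [hr, Set.ncard_range_of_injective hg]
  simp
  omega

theorem bookG_radius (k ε : ℕ) (t : ℝ) (ht : 0 < t) (htk : t ^ 2 = t + 2 * k) :
    ∃ μ, IsSpectralRadius (bookG k ε) μ ∧ t ≤ μ := by
  classical
  let F : ℕ → ℝ := fun i => if i < 2 then t else if i < k + 2 then 2 else 0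
  have hsum : ∀ (c : ℕ → Prop) [DecidablePred c], ∑ j : Fin (k + ε + 2), (if c j.val then F j.val else 0)
      = (if c 0 then t else 0) + (if c 1 then t else 0)
        + ∑ j ∈ Finset.range k, (if c (j + 2) then 2 else 0) := by
    intro c _
    rw [Fin.sum_univ_eq_sum_range (fun j => if c j then F j else 0), Finset.sum_range_succ',
      Finset.sum_range_succ', Finset.sum_range_add]
    have h0 : ∑ j ∈ Finset.range ε, (if c (k + j + 1 + 1) then F (k + j + 1 + 1) else 0) = 0 := by
      refine Finset.sum_eq_zero fun j _ => ?_
      have h1 : ¬ (k + j + 1 + 1 < 2) := by omega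
      have h2 : ¬ (k + j + 1 + 1 < k + 2) := by omega
      simp [F, h2]
    have h1 : ∑ j ∈ Finset.range k, (if c (j + 1 + 1) then F (j + 1 + 1) else 0)
        = ∑ j ∈ Finset.range k, (if c (j + 2) then 2 else 0) := by
      refine Finset.sum_congr rfl fun j hj => ?_
      have hj := Finset.mem_range.1 hj
      have h1 : ¬ (j + 1 + 1 < 2) := by omega
      have h2 : j + 1 + 1 < k + 2 := by omega
      simp only [F, h1, h2, if_true, if_false]
    rw [h0, h1]
    simp [F]
    ring
  apply exists_spectralRadius (bookG k ε) (fun i => F i.val) t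
  · intro h
    have := congrFun h ⟨0, by omega⟩
    simp [F] at this
    linarith
  · intro i
    have hmv : (adjMat (bookG k ε)).mulVec (fun i => F i.val) i
        = ∑ j : Fin (k + ε + 2), (if (i.val ≠ j.val ∧ (i.val = 0 ∨ j.val = 0 ∨
          (i.val = 1 ∧ j.val < k + 2) ∨ (j.val = 1 ∧ i.val < k + 2))) then F j.val else 0) := by
      simp [Matrix.mulVec, dotProduct, adjMat, bookG_adj]
    rw [hmv, hsum (fun j => i.val ≠ j ∧ (i.val = 0 ∨ j = 0 ∨
          (i.val = 1 ∧ j < k + 2) ∨ (j = 1 ∧ i.val < k + 2)))]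
    obtain ⟨i, hi⟩ := i
    simp only
    have F0 : F 0 = t := by simp [F]
    have F1 : F 1 = t := by simp [F]
    by_cases h0 : i = 0
    · subst h0
      have : ∑ j ∈ Finset.range k, (if (0 ≠ j + 2 ∧ (0 = 0 ∨ j + 2 = 0 ∨
          (0 = 1 ∧ j + 2 < k + 2) ∨ (j + 2 = 1 ∧ 0 < k + 2))) then (2:ℝ) else 0) = 2 * k := by
        rw [Finset.sum_congr rfl (g := fun _ => (2:ℝ))]
        · simp; ring
        · intro j hj
          rw [if_pos]
          omega
      rw [this, F0, if_neg, if_pos]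
      · linear_combination (-t) * htk
      · omega
      · omega
    by_cases h1 : i = 1
    · subst h1
      have : ∑ j ∈ Finset.range k, (if (1 ≠ j + 2 ∧ (1 = 0 ∨ j + 2 = 0 ∨
          (1 = 1 ∧ j + 2 < k + 2) ∨ (j + 2 = 1 ∧ 1 < k + 2))) then (2:ℝ) else 0) = 2 * k := by
        rw [Finset.sum_congr rfl (g := fun _ => (2:ℝ))]
        · simp; ring
        · intro j hj
          have hj := Finset.mem_range.1 hj
          rw [if_pos]
          omega
      rw [this, F1, if_pos, if_neg]
      · linear_combination (-t) * htk
      · omega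
      · omega
    have h3 : ¬ i < 2 := by omega
    by_cases h2 : i < k + 2
    · have Fi : F i = 2 := by simp only [F, h2, h3, if_true, if_false]
      have : ∑ j ∈ Finset.range k, (if (i ≠ j + 2 ∧ (i = 0 ∨ j + 2 = 0 ∨
          (i = 1 ∧ j + 2 < k + 2) ∨ (j + 2 = 1 ∧ i < k + 2))) then (2:ℝ) else 0) = 0 := by
        refine Finset.sum_eq_zero fun j _ => ?_
        rw [if_neg]
        omega
      rw [this, Fi, if_pos, if_pos]
      · ring
      · tauto
      · tauto
    · have Fi : F i = 0 := by simp only [F, h2, h3, if_false]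
      rw [Fi]; ring

theorem stmt9 {V : Type*} [Fintype V] (G : SimpleGraph V) (m : ℕ)
    (hm : G.edgeSet.ncard = m) (hm57 : 57 ≤ m)
    (hfree : ¬ Contains theta223 G)
    (hiso : ∀ v : V, ∃ w, G.Adj v w)
    (lam : ℝ) (hlam : IsSpectralRadius G lam)
    (hmax : ∀ (n : ℕ) (H : SimpleGraph (Fin n)) (μ : ℝ),
      H.edgeSet.ncard = m → ¬ Contains theta223 H → (∀ v, ∃ w, H.Adj v w) →
      IsSpectralRadius H μ → μ ≤ lam)
    (x : V → ℝ) (hx : ∀ v, 0 < x v)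
    (heig : (adjMat G).mulVec x = lam • x)
    (ustar : V) (hustar : ∀ v, x v ≤ x ustar) :
    ∀ c : (G.induce (G.neighborSet ustar)).ConnectedComponent,
      ¬ Nonempty (((G.induce (G.neighborSet ustar)).induce c.supp) ≃g K13e) := by
  classical
  rintro c ⟨φ⟩
  -- lower bound for the spectral radius
  obtain ⟨k, ε, hε, hmk⟩ : ∃ k ε : ℕ, ε ≤ 1 ∧ m = 2 * k + 1 + ε :=
    ⟨(m - 1) / 2, (m - 1) % 2, by omega, by omega⟩
  set t : ℝ := (1 + Real.sqrt (1 + 8 * k)) / 2 with ht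
  have hsq : Real.sqrt (1 + 8 * k) ^ 2 = 1 + 8 * k := Real.sq_sqrt (by positivity)
  have hsn : 0 ≤ Real.sqrt (1 + 8 * k) := Real.sqrt_nonneg _
  have htk : t ^ 2 = t + 2 * k := by rw [ht]; nlinarith
  have ht2 : 1 / 2 ≤ t := by rw [ht]; linarith
  obtain ⟨μ, hμ, htμ⟩ := bookG_radius k ε t (by linarith) htk
  have hlt : t ≤ lam := htμ.trans
    (hmax _ (bookG k ε) μ (by rw [bookG_edges, hmk]) (bookG_free k ε) (bookG_iso k ε) hμ)
  have hk2 : (m : ℝ) - 2 ≤ 2 * k := by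
    have : m ≤ 2 * k + 2 := by omega
    have : (m : ℝ) ≤ 2 * k + 2 := by exact_mod_cast this
    linarith
  have hlm : (m : ℝ) - 2 ≤ lam ^ 2 - lam := by nlinarith
  have hm57' : (57 : ℝ) ≤ m := by exact_mod_cast hm57
  have hl7 : 7 < lam := by nlinarith
  -- the vertices of the component
  let P : Fin 4 → V := fun i => ((φ.symm i).val.val)
  have hPU : ∀ i, G.Adj ustar (P i) := fun i => (φ.symm i).val.property
  have hPinj : ∀ i j, i ≠ j → P i ≠ P j := by
    intro i j hij h
    apply hij
    apply φ.symm.injective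
    exact Subtype.ext (Subtype.ext h)
  have hPadj : ∀ i j, G.Adj (P i) (P j) ↔ K13e.Adj i j := by
    intro i j
    rw [← φ.symm.map_adj_iff]
    simp [P]
  have hPcl : ∀ i v, G.Adj ustar v → G.Adj (P i) v → ∃ j, v = P j := by
    intro i v hv hiv
    have hmem : (⟨v, hv⟩ : G.neighborSet ustar) ∈ c.supp := by
      have h1 := (φ.symm i).property
      rw [SimpleGraph.ConnectedComponent.mem_supp_iff] at h1 ⊢
      rw [← h1]
      apply SimpleGraph.ConnectedComponent.sound
      apply SimpleGraph.Adj.reachable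
      exact hiv.symm
    refine ⟨φ ⟨⟨v, hv⟩, hmem⟩, ?_⟩
    show v = (φ.symm (φ ⟨⟨v, hv⟩, hmem⟩)).val.val
    rw [φ.symm_apply_apply]
  have hNP : ∀ i v, G.Adj ustar v → (G.Adj (P i) v ↔ ∃ j, K13e.Adj i j ∧ v = P j) := by
    intro i v hv
    constructor
    · intro h
      obtain ⟨j, rfl⟩ := hPcl i v hv h
      exact ⟨j, (hPadj i j).1 h, rfl⟩
    · rintro ⟨j, hj, rfl⟩
      exact (hPadj i j).2 hj
  have hxs := hx ustar
  refine core_s9 G m ?_ hfree lam hl7 hlm (fun v => x v / x ustar) (fun v => div_pos (hx v) hxs)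
    ustar (div_self hxs.ne') (fun v => (div_le_one hxs).2 (hustar v)) ?_
    (P 0) (P 1) (P 2) (P 3) (hPU 0) (hPU 1) (hPU 2) (hPU 3)
    (hPinj _ _ (by decide)) (hPinj _ _ (by decide)) (hPinj _ _ (by decide))
    (hPinj _ _ (by decide)) (hPinj _ _ (by decide)) (hPinj _ _ (by decide)) ?_ ?_ ?_ ?_
  · have h1 := G.sum_degrees_eq_twice_card_edges
    have h2 : G.edgeFinset.card = m := by
      rw [← hm, ← SimpleGraph.coe_edgeFinset, Set.ncard_coe_finset]
    rw [h2] at h1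
    exact_mod_cast h1
  · intro v
    have h1 := congrFun heig v
    simp only [Matrix.mulVec, dotProduct, adjMat, Matrix.of_apply, Pi.smul_apply, smul_eq_mul] at h1
    rw [← mul_div_assoc, ← h1, Finset.sum_div]
    refine Finset.sum_congr rfl fun w _ => ?_
    split_ifs <;> simp
  · intro v hv
    rw [hNP 0 v hv]
    simp [Fin.exists_fin_succ, K13e]
  · intro v hv
    rw [hNP 1 v hv]
    simp [Fin.exists_fin_succ, K13e]
  · intro v hv
    rw [hNP 2 v hv]
    simp [Fin.exists_fin_succ, K13e]
  · intro v hv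
    rw [hNP 3 v hv]
    simp [Fin.exists_fin_succ, K13e]
end
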